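/- arXiv:1609.00303 — 3 statements merged into one kernel-verified Lean document; each statement's English description precedes it below -/
import Mathlib

section
/- Let X be a dendrite (a nonempty compact, connected, metrizable space that is locally connected and contains no simple closed curve) and let 𝒴 be a finite collection of closed connected subsets of X such that any two members of 𝒴 have nonempty intersection. Then the intersection of all members of 𝒴 is nonempty. -/
open Set

/-- A dendrite: a nonempty compact connected metrizable space that is locally
connected and contains no simple closed curve (no subspace homeomorphic to the circle). -/
def IsDendrite (X : Type*) [TopologicalSpace X] : Prop :=
  Nonempty X ∧ CompactSpace X ∧ ConnectedSpace X ∧ TopologicalSpace.MetrizableSpace X ∧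
    LocallyConnectedSpace X ∧ ¬ ∃ S : Set X, Nonempty (S ≃ₜ Circle)


namespace DendriteHelly
open Filter Topology

/-- Uniform local connectedness. -/
theorem ulc {X : Type*} [MetricSpace X] [CompactSpace X] [LocallyConnectedSpace X]
    {ε : ℝ} (hε : 0 < ε) : ∃ δ > 0, ∀ x y : X, dist x y < δ →
      ∃ C : Set X, IsPreconnected C ∧ x ∈ C ∧ y ∈ C ∧ C ⊆ Metric.ball x ε := by
  obtain ⟨δ, hδ, h⟩ := lebesgue_number_lemma_of_metric (s := (univ : Set X))
    (c := fun x : X => connectedComponentIn (Metric.ball x (ε / 2)) x) isCompact_univ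
    (fun i => Metric.isOpen_ball.connectedComponentIn)
    (fun x _ => mem_iUnion.2 ⟨x, mem_connectedComponentIn (Metric.mem_ball_self (by positivity))⟩)
  refine ⟨δ, hδ, fun x y hxy => ?_⟩
  obtain ⟨i, hi⟩ := h x trivial
  have hx := hi (Metric.mem_ball_self hδ)
  refine ⟨_, isPreconnected_connectedComponentIn, hx,
    hi (by rwa [Metric.mem_ball, dist_comm]), fun z hz => ?_⟩
  have h1 := connectedComponentIn_subset _ _ hx
  have h2 := connectedComponentIn_subset _ _ hz
  rw [Metric.mem_ball] at *
  linarith [dist_triangle_right z x i]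

/-- `Ch δ S n x y`: a chain with `n` steps of size `< δ` from `x` to `y` with points in `S`. -/
def Ch {X : Type*} [MetricSpace X] (δ : ℝ) (S : Set X) : ℕ → X → X → Prop
  | 0, x, y => x = y
  | n + 1, x, y => ∃ z ∈ S, dist x z < δ ∧ Ch δ S n z y

theorem Ch.mono {X : Type*} [MetricSpace X] {δ δ' : ℝ} {S T : Set X} (h : δ ≤ δ') (hST : S ⊆ T) :
    ∀ {n : ℕ} {x y : X}, Ch δ S n x y → Ch δ' T n x y
  | 0, _, _, hc => hc
  | _ + 1, _, _, ⟨z, hz, hd, hc⟩ => ⟨z, hST hz, hd.trans_le h, hc.mono h hST⟩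

theorem Ch.trans {X : Type*} [MetricSpace X] {δ : ℝ} {S : Set X} {n : ℕ} :
    ∀ {m : ℕ} {x y z : X}, Ch δ S m x y → Ch δ S n y z → Ch δ S (m + n) x z
  | 0, x, y, z, h, h' => by
      have : x = y := h
      subst this; simpa using h'
  | m + 1, x, y, z, ⟨w, hw, hd, hc⟩, h' => by
      have := hc.trans h'
      rw [show m + 1 + n = (m + n) + 1 by omega]
      exact ⟨w, hw, hd, this⟩

theorem Ch.pad {X : Type*} [MetricSpace X] {δ : ℝ} (hδ : 0 < δ) {S : Set X} {n m : ℕ} {x y : X}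
    (hx : x ∈ S) (h : Ch δ S n x y) (hnm : n ≤ m) : Ch δ S m x y := by
  induction m, hnm using Nat.le_induction with
  | base => exact h
  | succ k _ ih => exact ⟨x, hx, by simpa using hδ, ih⟩

theorem Ch.fn {X : Type*} [MetricSpace X] {δ : ℝ} {S : Set X} :
    ∀ {n : ℕ} {x y : X}, x ∈ S → Ch δ S n x y → ∃ z : ℕ → X, z 0 = x ∧ z n = y ∧
      (∀ i < n, dist (z i) (z (i + 1)) < δ) ∧ ∀ i ≤ n, z i ∈ S
  | 0, x, y, hx, h => ⟨fun _ => x, rfl, h, by simp, fun _ _ => hx⟩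
  | n + 1, x, y, hx, ⟨w, hw, hd, hc⟩ => by
      obtain ⟨z, h0, h1, h2, h3⟩ := hc.fn hw
      refine ⟨fun i => Nat.casesOn i x z, rfl, h1, ?_, ?_⟩
      · rintro (_ | i) hi
        · simpa [h0] using hd
        · exact h2 i (by omega)
      · rintro (_ | i) hi
        · exact hx
        · exact h3 i (by omega)

theorem chain_exists {X : Type*} [MetricSpace X] {δ : ℝ} (hδ : 0 < δ) {C : Set X}
    (hC : IsPreconnected C) {x y : X} (hx : x ∈ C) (hy : y ∈ C) : ∃ n, Ch δ C n x y := by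
  refine hC.induction₂' (fun x y => ∃ n, Ch δ C n x y) ?_ ?_ hx hy
  · intro x hx
    filter_upwards [mem_nhdsWithin_of_mem_nhds (Metric.ball_mem_nhds x hδ),
      self_mem_nhdsWithin] with y hy hyC
    rw [Metric.mem_ball] at hy
    exact ⟨⟨1, y, hyC, by rwa [dist_comm], rfl⟩, ⟨1, x, hx, hy, rfl⟩⟩
  · rintro x y z - - - ⟨m, h⟩ ⟨n, h'⟩
    exact ⟨m + n, h.trans h'⟩

theorem uniform_chain {X : Type*} [MetricSpace X] [CompactSpace X] [LocallyConnectedSpace X]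
    {ε : ℝ} (hε : 0 < ε) : ∃ δ > 0, δ ≤ ε ∧ ∀ δ' > 0, ∃ M : ℕ, 0 < M ∧ ∀ x y : X, dist x y < δ →
      ∃ z : ℕ → X, z 0 = x ∧ z M = y ∧ (∀ i < M, dist (z i) (z (i + 1)) < δ') ∧
        ∀ i ≤ M, dist x (z i) < ε := by
  obtain ⟨δ₁, hδ₁, H⟩ := ulc (X := X) (half_pos hε)
  refine ⟨min (δ₁ / 2) (ε / 2), by positivity, (min_le_right _ _).trans (by linarith),
    fun δ' hδ' => ?_⟩
  obtain ⟨r, hr0, hr1, hr2, hr3⟩ : ∃ r > 0, r ≤ δ' ∧ r ≤ ε / 4 ∧ r ≤ δ₁ / 4 :=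
    ⟨min δ' (min (ε / 4) (δ₁ / 4)), by positivity, min_le_left _ _,
      (min_le_right _ _).trans (min_le_left _ _), (min_le_right _ _).trans (min_le_right _ _)⟩
  obtain ⟨t, -, htf, ht⟩ := finite_cover_balls_of_compact (isCompact_univ (X := X)) hr0
  have key : ∀ p : X × X, ∃ m : ℕ, dist p.1 p.2 < δ₁ → Ch δ' (Metric.ball p.1 (ε / 2)) m p.1 p.2 := by
    intro p
    by_cases hp : dist p.1 p.2 < δ₁
    · obtain ⟨C, hC, h1, h2, h3⟩ := H _ _ hp
      obtain ⟨n, hn⟩ := chain_exists hδ' hC h1 h2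
      exact ⟨n, fun _ => hn.mono le_rfl h3⟩
    · exact ⟨0, fun h => absurd h hp⟩
  choose m hm using key
  obtain ⟨M, hM⟩ := ((htf.prod htf).image m).bddAbove
  refine ⟨M + 2, by omega, fun x y hxy => ?_⟩
  obtain ⟨c, hc, hxc⟩ := mem_iUnion₂.1 (ht (mem_univ x))
  obtain ⟨c', hc', hyc⟩ := mem_iUnion₂.1 (ht (mem_univ y))
  rw [Metric.mem_ball] at hxc hyc
  have hxy1 := hxy.trans_le (min_le_left _ _)
  have hxy2 := hxy.trans_le (min_le_right _ _)
  have hcc : dist c c' < δ₁ := by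
    have := dist_triangle4 c x y c'
    rw [dist_comm c x] at this
    linarith
  have h1 := (hm (c, c') hcc).pad hδ' (Metric.mem_ball_self (half_pos hε))
    (hM (mem_image_of_mem m (mk_mem_prod hc hc')))
  have h2 : Ch δ' (Metric.ball x ε) M c c' := h1.mono le_rfl (fun z hz => by
    rw [Metric.mem_ball] at *
    have := dist_triangle z c x
    rw [dist_comm c x] at this
    dsimp only at hz
    linarith)
  have h3 : Ch δ' (Metric.ball x ε) (M + 1) x c' :=
    ⟨c, by rw [Metric.mem_ball, dist_comm]; linarith, by linarith, h2⟩
  have h4 : Ch δ' (Metric.ball x ε) (M + 1 + 1) x y :=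
    h3.trans ⟨y, by rw [Metric.mem_ball, dist_comm]; linarith, by rw [dist_comm]; linarith, rfl⟩
  obtain ⟨z, a, b, c, d⟩ := h4.fn (Metric.mem_ball_self hε)
  exact ⟨z, a, b, c, fun i hi => by have := d i hi; rwa [Metric.mem_ball, dist_comm] at this⟩

theorem nat_floor_close {a b : ℝ} (h : a ≤ b) (h' : b < a + 1) :
    ⌊b⌋₊ = ⌊a⌋₊ ∨ ⌊b⌋₊ = ⌊a⌋₊ + 1 := by
  have h1 := Nat.floor_mono h
  have h2 : ⌊b⌋₊ < ⌊a⌋₊ + 2 := by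
    by_cases hb : 0 ≤ b
    · rw [Nat.floor_lt hb]
      have := Nat.lt_floor_add_one a
      push_cast; linarith
    · rw [Nat.floor_of_nonpos (by linarith)]; omega
  omega

theorem small_path {X : Type*} [MetricSpace X] [CompactSpace X] [LocallyConnectedSpace X]
    {ε : ℝ} (hε : 0 < ε) : ∃ δ > 0, ∀ x y : X, dist x y < δ → JoinedIn (Metric.ball x ε) x y := by
  have hE : ∀ n : ℕ, 0 < (ε / 2) / 2 / 2 ^ n := fun n => by positivity
  choose δ hδ hδε U using fun n : ℕ => uniform_chain (X := X) (hE n)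
  choose M hM0 hM using fun n : ℕ => U n (δ (n + 1)) (hδ (n + 1))
  have hM' : ∀ n (x y : X), ∃ z : ℕ → X, dist x y < δ n → z 0 = x ∧ z (M n) = y ∧
      (∀ i < M n, dist (z i) (z (i + 1)) < δ (n + 1)) ∧
        ∀ i ≤ M n, dist x (z i) < (ε / 2) / 2 / 2 ^ n := by
    intro n x y
    by_cases h : dist x y < δ n
    · obtain ⟨z, hz⟩ := hM n x y h
      exact ⟨z, fun _ => hz⟩
    · exact ⟨fun _ => x, fun h' => absurd h' h⟩
  choose Z hZ using hM'
  refine ⟨δ 0, hδ 0, fun x y hxy => ?_⟩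
  let f : ℕ → ℕ → X := fun n => Nat.rec (fun k => if k = 0 then x else y)
    (fun n g i => Z n (g (i / M n)) (g (i / M n + 1)) (i % M n)) n
  have fs : ∀ n i, f (n + 1) i = Z n (f n (i / M n)) (f n (i / M n + 1)) (i % M n) := fun n i => rfl
  have f0 : ∀ k, f 0 k = if k = 0 then x else y := fun k => rfl
  have hA : ∀ n k, dist (f n k) (f n (k + 1)) < δ n := by
    intro n
    induction n with
    | zero =>
      intro k
      rw [f0, f0]
      rcases Nat.eq_zero_or_pos k with hk | hk
      · subst hk; simpa using hxy
      · simpa [hk.ne'] using hδ 0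
    | succ n ih =>
      have hB : ∀ k j, j ≤ M n →
          f (n + 1) (M n * k + j) = Z n (f n k) (f n (k + 1)) j := by
        intro k j hj
        rcases hj.lt_or_eq with hj | hj
        · rw [fs, Nat.mul_add_div (hM0 n), Nat.div_eq_of_lt hj, Nat.mul_add_mod,
            Nat.mod_eq_of_lt hj, add_zero]
        · subst hj
          rw [fs, show M n * k + M n = M n * (k + 1) by ring, Nat.mul_div_cancel_left _ (hM0 n),
            Nat.mul_mod_right, (hZ n _ _ (ih (k + 1))).1, (hZ n _ _ (ih k)).2.1]
      intro i
      have hi := Nat.mod_lt i (hM0 n)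
      have e := Nat.div_add_mod i (M n)
      have e1 := hB (i / M n) (i % M n) hi.le
      have e2 := hB (i / M n) (i % M n + 1) hi
      rw [← add_assoc, e] at e2
      rw [e] at e1
      rw [e1, e2]
      exact (hZ n _ _ (ih _)).2.2.1 _ hi
  let D : ℕ → ℕ := fun n => ∏ i ∈ Finset.range n, M i
  have D0 : D 0 = 1 := by simp [D]
  have Ds : ∀ n, D (n + 1) = D n * M n := fun n => Finset.prod_range_succ _ _
  have Dpos : ∀ n, 0 < D n := fun n => Finset.prod_pos fun i _ => hM0 i
  have fzero : ∀ n, f n 0 = x := by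
    intro n
    induction n with
    | zero => simp [f0]
    | succ n ih =>
      rw [fs, Nat.zero_div, Nat.zero_mod, (hZ n _ _ (hA n 0)).1, ih]
  have fD : ∀ n, f n (D n) = y := by
    intro n
    induction n with
    | zero => simp [f0, D0]
    | succ n ih =>
      rw [fs, Ds, Nat.mul_div_cancel _ (hM0 n), Nat.mul_mod_left, (hZ n _ _ (hA n _)).1, ih]
  let g : ℝ → ℕ → X := fun t n => f n ⌊t * D n⌋₊
  have hg : ∀ t n, dist (g t n) (g t (n + 1)) ≤ (ε / 2) / 2 / 2 ^ n := by
    intro t n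
    have e : ⌊t * D n⌋₊ = ⌊t * D (n + 1)⌋₊ / M n := by
      rw [← Nat.floor_div_natCast, Ds]
      push_cast
      have : (M n : ℝ) ≠ 0 := by exact_mod_cast (hM0 n).ne'
      congr 1
      field_simp
    simp only [g]
    rw [fs, ← e]
    exact ((hZ n _ _ (hA n _)).2.2.2 _ (Nat.mod_lt _ (hM0 n)).le).le
  have hlim : ∀ t, ∃ p, Tendsto (g t) atTop (𝓝 p) := fun t =>
    cauchySeq_tendsto_of_complete (cauchySeq_of_le_geometric_two (hg t))
  choose G hG using hlim
  have hGd : ∀ t n, dist (g t n) (G t) ≤ (ε / 2) / 2 ^ n := fun t n =>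
    dist_le_of_le_geometric_two_of_tendsto (hg t) (hG t) n
  have G0 : G 0 = x := by
    refine tendsto_nhds_unique (hG 0) ?_
    have : g 0 = fun _ => x := by ext n; simp [g, fzero]
    rw [this]; exact tendsto_const_nhds
  have G1 : G 1 = y := by
    refine tendsto_nhds_unique (hG 1) ?_
    have : g 1 = fun _ => y := by ext n; simp [g, fD]
    rw [this]; exact tendsto_const_nhds
  have near : ∀ (n : ℕ) (s t : ℝ), s ≤ t → t < s + 1 / D n → dist (g s n) (g t n) ≤ ε / 2 ^ n := by
    intro n s t hst hts
    have hD : (0 : ℝ) < D n := by exact_mod_cast Dpos n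
    have h2 : t * D n < s * D n + 1 := by
      have := mul_lt_mul_of_pos_right hts hD
      rwa [add_mul, one_div, inv_mul_cancel₀ hD.ne'] at this
    have hp : (0 : ℝ) < 2 ^ n := by positivity
    rcases nat_floor_close (mul_le_mul_of_nonneg_right hst hD.le) h2 with h | h
    · simp only [g, h, dist_self]; positivity
    · simp only [g, h]
      refine ((hA n _).le.trans (hδε n)).trans ?_
      gcongr; linarith
  have hcont : Continuous G := by
    rw [Metric.continuous_iff]
    intro t η hη
    obtain ⟨n, hn⟩ : ∃ n : ℕ, 2 * ε / 2 ^ n < η := by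
      have : Tendsto (fun n : ℕ => 2 * ε / 2 ^ n) atTop (𝓝 0) :=
        tendsto_const_nhds.div_atTop (tendsto_pow_atTop_atTop_of_one_lt (by norm_num))
      exact (this.eventually (gt_mem_nhds hη)).exists
    have hD : (0 : ℝ) < D n := by exact_mod_cast Dpos n
    refine ⟨1 / D n, by positivity, fun s hs => ?_⟩
    rw [Real.dist_eq, abs_lt] at hs
    have : dist (g s n) (g t n) ≤ ε / 2 ^ n := by
      rcases le_total s t with h | h
      · exact near n s t h (by linarith)
      · rw [dist_comm]; exact near n t s h (by linarith)
    have h1 := hGd s n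
    have h2 := hGd t n
    have h3 := dist_triangle4 (G s) (g s n) (g t n) (G t)
    rw [dist_comm (G s) (g s n)] at h3
    have h4 : 2 * ε / 2 ^ n = (ε / 2) / 2 ^ n + ε / 2 ^ n + (ε / 2) / 2 ^ n := by ring
    linarith
  refine JoinedIn.ofLine hcont.continuousOn G0 G1 ?_
  rintro _ ⟨t, ht, rfl⟩
  rw [Metric.mem_ball, dist_comm]
  rcases ht.2.lt_or_eq with h | h
  · have h1 := hGd t 0
    have h2 : g t 0 = x := by
      simp only [g, D0, f0]
      rw [if_pos]
      simp [Nat.floor_eq_zero, h]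
    rw [h2] at h1
    simp at h1
    linarith
  · rw [h, G1]
    have := hδε 0
    simp at this
    linarith

theorem locPath {X : Type*} [MetricSpace X] [CompactSpace X] [LocallyConnectedSpace X] :
    LocallyPathConnectedSpace X := by
  rw [locallyPathConnectedSpace_iff_pathComponentIn_mem_nhds]
  intro x u hu hx
  obtain ⟨ε, hε, h⟩ := Metric.isOpen_iff.1 hu x hx
  obtain ⟨δ, hδ, H⟩ := small_path (X := X) hε
  filter_upwards [Metric.ball_mem_nhds x hδ] with y hy
  exact (H x y (by rwa [dist_comm])).mono h


theorem gap_around {F : Set ℝ} (hF : IsClosed F) {a b m : ℝ} (ha : a ∈ F) (hb : b ∈ F)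
    (ham : a ≤ m) (hmb : m ≤ b) (hm : m ∉ F) : ∃ a' ∈ F, ∃ b' ∈ F, a ≤ a' ∧ a' < m ∧ m < b' ∧
      b' ≤ b ∧ ∀ c ∈ F, ¬ (a' < c ∧ c < b') := by
  obtain ⟨a', ha', ha''⟩ := (isCompact_Icc.inter_left hF : IsCompact (F ∩ Icc a m)).exists_isGreatest
    ⟨a, ha, le_rfl, ham⟩
  obtain ⟨b', hb', hb''⟩ := (isCompact_Icc.inter_left hF : IsCompact (F ∩ Icc m b)).exists_isLeast
    ⟨b, hb, hmb, le_rfl⟩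
  refine ⟨a', ha'.1, b', hb'.1, ha'.2.1, lt_of_le_of_ne ha'.2.2 ?_, lt_of_le_of_ne hb'.2.1 ?_,
    hb'.2.2, ?_⟩
  · rintro rfl; exact hm ha'.1
  · rintro rfl; exact hm hb'.1
  · rintro c hc ⟨h1, h2⟩
    rcases le_total c m with h | h
    · exact absurd (ha'' ⟨hc, ha'.2.1.trans h1.le, h⟩) (not_le.2 h1)
    · exact absurd (hb'' ⟨hc, h, h2.le.trans hb'.2.2⟩) (not_le.2 h2)

/-- Closed subsets of the unit interval such that `γ` takes equal values at the ends of gaps. -/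
def Good {X : Type*} (γ : ℝ → X) (F : Set ℝ) : Prop :=
  IsClosed F ∧ F ⊆ Icc 0 1 ∧ 0 ∈ F ∧ 1 ∈ F ∧
    ∀ a ∈ F, ∀ b ∈ F, a < b → (∀ c ∈ F, ¬ (a < c ∧ c < b)) → γ a = γ b

theorem exists_minimal_good {X : Type*} [TopologicalSpace X] [T2Space X] {γ : ℝ → X}
    (hγ : Continuous γ) : ∃ F, Minimal (· ∈ {F | Good γ F}) F := by
  refine zorn_superset _ ?_
  intro c hc hch
  rcases c.eq_empty_or_nonempty with rfl | hne
  · refine ⟨Icc 0 1, ⟨isClosed_Icc, subset_rfl, by simp, by simp, ?_⟩, by simp⟩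
    intro a ha b hb hab h
    exact absurd ⟨by linarith, by linarith⟩ (h ((a + b) / 2) ⟨by linarith [ha.1, hb.1], by linarith [ha.2, hb.2]⟩)
  refine ⟨⋂₀ c, ⟨isClosed_sInter fun F hF => (hc hF).1, ?_, fun F hF => (hc hF).2.2.1,
    fun F hF => (hc hF).2.2.2.1, ?_⟩, fun s hs => sInter_subset_of_mem hs⟩
  · obtain ⟨F, hF⟩ := hne
    exact (sInter_subset_of_mem hF).trans (hc hF).2.1
  intro a ha b hb hab hgap
  by_contra hne'
  obtain ⟨U, V, hU, hV, haU, hbV, hUV⟩ := t2_separation hne'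
  obtain ⟨ε₁, h₁, hε₁⟩ := Metric.isOpen_iff.1 (hU.preimage hγ) a haU
  obtain ⟨ε₂, h₂, hε₂⟩ := Metric.isOpen_iff.1 (hV.preimage hγ) b hbV
  obtain ⟨r, hr, hr1, hr2, hr3⟩ : ∃ r > 0, r < ε₁ ∧ r < ε₂ ∧ r < (b - a) / 2 := by
    obtain ⟨r, hr, hr'⟩ := exists_between (show 0 < min ε₁ (min ε₂ ((b - a) / 2)) from
      lt_min h₁ (lt_min h₂ (by linarith)))
    exact ⟨r, hr, by simp only [lt_min_iff] at hr'; tauto⟩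
  have : Nonempty c := hne.to_subtype
  obtain ⟨⟨F, hF⟩, hFK⟩ := IsCompact.elim_directed_family_closed (isCompact_Icc (a := a + r) (b := b - r))
    (fun i : c => (i : Set ℝ)) (fun i => (hc i.2).1) (by
      rw [← sInter_eq_iInter]
      ext z
      simp only [mem_inter_iff, mem_empty_iff_false, iff_false, not_and]
      intro hz hz'
      exact hgap z hz' ⟨by linarith [hz.1], by linarith [hz.2]⟩)
    (by
      intro i j
      rcases hch.total i.2 j.2 with h | h
      · exact ⟨i, subset_rfl, h⟩
      · exact ⟨j, h, subset_rfl⟩)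
  have hK : ∀ z ∈ F, a + r ≤ z → z ≤ b - r → False := fun z hz h1 h2 => by
    have : z ∈ Icc (a + r) (b - r) ∩ F := ⟨⟨h1, h2⟩, hz⟩
    rw [hFK] at this; exact this
  obtain ⟨a', ha', b', hb', h1, h2, h3, h4, h5⟩ := gap_around (hc hF).1 (ha F hF) (hb F hF)
    (m := (a + b) / 2) (by linarith) (by linarith)
    (fun h => hK _ h (by linarith) (by linarith))
  have e := (hc hF).2.2.2.2 a' ha' b' hb' (by linarith) h5
  have h6 : a' < a + r := by
    by_contra h; exact hK a' ha' (by linarith) (by linarith)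
  have h7 : b - r < b' := by
    by_contra h; exact hK b' hb' (by linarith) (by linarith)
  have m1 : γ a' ∈ U := hε₁ (by rw [Metric.mem_ball, Real.dist_eq, abs_lt]; constructor <;> linarith)
  have m2 : γ b' ∈ V := hε₂ (by rw [Metric.mem_ball, Real.dist_eq, abs_lt]; constructor <;> linarith)
  rw [e] at m1
  exact disjoint_left.1 hUV m1 m2

theorem minimal_good_gap {X : Type*} {γ : ℝ → X} {F : Set ℝ}
    (hF : Minimal (· ∈ {F | Good γ F}) F) {a b c : ℝ} (ha : a ∈ F) (hb : b ∈ F) (hc : c ∈ F)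
    (hac : a < c) (hcb : c < b) : γ a ≠ γ b := by
  intro e
  obtain ⟨h1, h2, h3, h4, h5⟩ := hF.prop
  have hG : Good γ (F \ Ioo a b) := by
    refine ⟨h1.sdiff isOpen_Ioo, sdiff_subset.trans h2, ⟨h3, fun h => ?_⟩, ⟨h4, fun h => ?_⟩, ?_⟩
    · exact absurd (h2 ha).1 (not_le.2 h.1)
    · exact absurd (h2 hb).2 (not_le.2 h.2)
    · intro a' ha' b' hb' hab' hg
      by_cases hx : ∃ x ∈ F, a' < x ∧ x < b'
      · obtain ⟨x, hx, hx1, hx2⟩ := hx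
        have hxI : x ∈ Ioo a b := by
          by_contra h; exact hg x ⟨hx, h⟩ ⟨hx1, hx2⟩
        have e1 : a' = a := by
          rcases lt_trichotomy a' a with h | h | h
          · exact absurd ⟨h, hxI.1.trans hx2⟩ (hg a ⟨ha, by simp⟩)
          · exact h
          · exact absurd ⟨h, hx1.trans hxI.2⟩ ha'.2
        have e2 : b' = b := by
          rcases lt_trichotomy b' b with h | h | h
          · exact absurd ⟨hxI.1.trans hx2, h⟩ hb'.2
          · exact h
          · exact absurd ⟨hx1.trans hxI.2, h⟩ (hg b ⟨hb, by simp⟩)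
        rw [e1, e2, e]
      · push Not at hx
        exact h5 a' ha'.1 b' hb'.1 hab' (fun c hc h => absurd h.2 (not_lt.2 (hx c hc h.1)))
  exact (hF.2 hG sdiff_subset hc).2 ⟨hac, hcb⟩

theorem exists_order_dense {X : Type*} {γ : ℝ → X} {F : Set ℝ}
    (hF : Minimal (· ∈ {F | Good γ F}) F) : ∃ D : Set ℝ, D.Countable ∧ D ⊆ F ∧
      (∀ d ∈ D, 0 < d ∧ γ d ≠ γ 1 ∧ ∀ w ∈ F, w < d → γ w ≠ γ d) ∧
      ∀ x ∈ F, ∀ y ∈ F, x < y → γ x ≠ γ y → ∃ d ∈ D, x < d ∧ d < y := by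
  have hgap := @minimal_good_gap X γ F hF
  obtain ⟨h1, h2, h3, h4, h5⟩ := hF.prop
  have hgap' : ∀ x ∈ F, ∀ y ∈ F, x < y → γ x ≠ γ y → ∃ z ∈ F, x < z ∧ z < y := by
    intro x hx y hy hxy hne
    by_contra h
    push Not at h
    exact hne (h5 x hx y hy hxy fun c hc h' => absurd h'.2 (not_lt.2 (h c hc h'.1)))
  let L : Set ℝ := {x | x ∈ F ∧ ∀ w ∈ F, w < x → γ w ≠ γ x}
  have hL : ∀ w ∈ F, ∀ z ∈ F, w < z → γ w = γ z → w ∈ L := by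
    intro w hw z hz hwz e
    refine ⟨hw, fun w' hw' hlt e' => ?_⟩
    exact hgap hw' hz hw hlt hwz (e'.trans e)
  have hdens : ∀ x ∈ F, ∀ y ∈ F, x < y → γ x ≠ γ y → ∃ z ∈ L, x < z ∧ z < y := by
    intro x hx y hy hxy hne
    obtain ⟨z, hz, hxz, hzy⟩ := hgap' x hx y hy hxy hne
    by_cases hzL : z ∈ L
    · exact ⟨z, hzL, hxz, hzy⟩
    obtain ⟨w, hw, hwz, e⟩ : ∃ w ∈ F, w < z ∧ γ w = γ z := by
      by_contra h; push Not at h; exact hzL ⟨hz, h⟩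
    rcases lt_trichotomy w x with h | h | h
    · exact absurd e (hgap hw hz hx h hxz)
    · subst h
      obtain ⟨z', hz', hzz', hz'y⟩ := hgap' z hz y hy hzy (by rwa [← e])
      by_cases hzL' : z' ∈ L
      · exact ⟨z', hzL', hxz.trans hzz', hz'y⟩
      obtain ⟨w', hw', hwz', e'⟩ : ∃ w ∈ F, w < z' ∧ γ w = γ z' := by
        by_contra h; push Not at h; exact hzL' ⟨hz', h⟩
      rcases lt_trichotomy w' z with h' | h' | h'
      · exact absurd e' (hgap hw' hz' hz h' hzz')
      · subst h'
        exact absurd (e.trans e') (hgap hw hz' hz hwz hzz')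
      · exact ⟨w', hL w' hw' z' hz' hwz' e', hxz.trans h', hwz'.trans hz'y⟩
    · exact ⟨w, hL w hw z hz hwz e, h, hwz.trans hzy⟩
  obtain ⟨D, hDL, hDc, hDd⟩ :=
    (TopologicalSpace.IsSeparable.of_separableSpace L).exists_countable_dense_subset
  have hD : ∀ x ∈ F, ∀ y ∈ F, x < y → γ x ≠ γ y → ∃ d ∈ D, x < d ∧ d < y := by
    intro x hx y hy hxy hne
    obtain ⟨z, hz, hz'⟩ := hdens x hx y hy hxy hne
    obtain ⟨d, hd, hd'⟩ := mem_closure_iff.1 (hDd hz) (Ioo x y) isOpen_Ioo hz'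
    exact ⟨d, hd', hd⟩
  refine ⟨D ∩ {d | 0 < d ∧ γ d ≠ γ 1}, hDc.mono inter_subset_left, fun d hd => (hDL hd.1).1,
    fun d hd => ⟨hd.2.1, hd.2.2, (hDL hd.1).2⟩, ?_⟩
  intro x hx y hy hxy hne
  obtain ⟨d, hd, hxd, hdy⟩ := hD x hx y hy hxy hne
  obtain ⟨d', hd', hxd', hdd'⟩ := hD x hx d (hDL hd).1 hxd ((hDL hd).2 x hx hxd)
  exact ⟨d', ⟨hd', (h2 hx).1.trans_lt hxd', hgap (hDL hd').1 h4 (hDL hd).1 hdd'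
    (hdy.trans_le (h2 hy).2)⟩, hxd', hdd'.trans hdy⟩

theorem exists_staircase {X : Type*} {γ : ℝ → X} (h01 : γ 0 ≠ γ 1) {F : Set ℝ}
    (hF : Minimal (· ∈ {F | Good γ F}) F) : ∃ φ : ℝ → ℝ, Continuous φ ∧ φ 0 = 0 ∧ φ 1 = 1 ∧
      φ '' F = Icc 0 1 ∧ ∀ x ∈ F, ∀ y ∈ F, (φ x = φ y ↔ γ x = γ y) := by
  have hgap := @minimal_good_gap X γ F hF
  obtain ⟨D, hDc, hDF, hD1, hD2⟩ := exists_order_dense hF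
  obtain ⟨h1, h2, h3, h4, h5⟩ := hF.prop
  have : Countable D := hDc.to_subtype
  have : Nonempty D := by
    obtain ⟨d, hd, -⟩ := hD2 0 h3 1 h4 one_pos h01
    exact ⟨⟨d, hd⟩⟩
  have : DenselyOrdered D := ⟨fun x y hxy => by
    obtain ⟨d, hd, hd1, hd2⟩ := hD2 x (hDF x.2) y (hDF y.2) hxy ((hD1 y y.2).2.2 x (hDF x.2) hxy)
    exact ⟨⟨d, hd⟩, hd1, hd2⟩⟩
  have : NoMinOrder D := ⟨fun x => by
    obtain ⟨d, hd, hd1, hd2⟩ := hD2 0 h3 x (hDF x.2) (hD1 x x.2).1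
      ((hD1 x x.2).2.2 0 h3 (hD1 x x.2).1)
    exact ⟨⟨d, hd⟩, hd2⟩⟩
  have : NoMaxOrder D := ⟨fun x => by
    have hne := (hD1 x x.2).2.1
    obtain ⟨d, hd, hd1, hd2⟩ := hD2 x (hDF x.2) 1 h4
      (lt_of_le_of_ne (h2 (hDF x.2)).2 (fun h => hne (by rw [h]))) hne
    exact ⟨⟨d, hd⟩, hd1⟩⟩
  have : Nonempty (Ioo (0 : ℚ) 1) := ⟨⟨1 / 2, by norm_num, by norm_num⟩⟩
  obtain ⟨e⟩ := Order.iso_of_countable_dense D (Ioo (0 : ℚ) 1)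
  let E : D → ℝ := fun d => ((e d : ℚ) : ℝ)
  have E0 : ∀ d, 0 < E d := fun d => by simp only [E]; exact_mod_cast (e d).2.1
  have E1 : ∀ d, E d < 1 := fun d => by simp only [E]; exact_mod_cast (e d).2.2
  have Elt : ∀ d d' : D, E d < E d' ↔ d < d' := fun d d' => by
    rw [← e.lt_iff_lt]; simp only [E]; norm_cast
  have Ele : ∀ d d' : D, d ≤ d' → E d ≤ E d' := fun d d' h => by
    by_contra hh; rw [not_le, Elt] at hh; exact absurd h (not_le.2 hh)
  have Esurj : ∀ a b : ℝ, 0 ≤ a → a < b → b ≤ 1 → ∃ d, a < E d ∧ E d < b := by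
    intro a b ha hab hb
    obtain ⟨q, hq1, hq2⟩ := exists_rat_btwn hab
    obtain ⟨d, hd⟩ := e.surjective ⟨q, by exact_mod_cast ha.trans_lt hq1,
      by exact_mod_cast hq2.trans_le hb⟩
    refine ⟨d, ?_⟩
    simp only [E, hd]
    exact ⟨hq1, hq2⟩
  let S : ℝ → Set ℝ := fun t => insert 0 (E '' {d | (d : ℝ) ≤ t})
  have Sb : ∀ t, BddAbove (S t) := fun t => ⟨1, by
    rintro _ (rfl | ⟨d, -, rfl⟩)
    · exact zero_le_one
    · exact (E1 d).le⟩
  let φ : ℝ → ℝ := fun t => sSup (S t)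
  have φ0 : ∀ t, 0 ≤ φ t := fun t => le_csSup (Sb t) (mem_insert _ _)
  have φ1 : ∀ t, φ t ≤ 1 := fun t => csSup_le (insert_nonempty _ _) (by
    rintro _ (rfl | ⟨d, -, rfl⟩)
    · exact zero_le_one
    · exact (E1 d).le)
  have φa : ∀ (d : D) t, (d : ℝ) ≤ t → E d ≤ φ t := fun d t h =>
    le_csSup (Sb t) (Or.inr ⟨d, h, rfl⟩)
  have φb : ∀ (d : D) t, t ≤ (d : ℝ) → φ t ≤ E d := fun d t h =>
    csSup_le (insert_nonempty _ _) (by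
      rintro _ (rfl | ⟨d', hd', rfl⟩)
      · exact (E0 d).le
      · exact Ele _ _ (show (d' : ℝ) ≤ d from le_trans hd' h))
  have φd : ∀ d : D, φ d = E d := fun d => le_antisymm (φb d d le_rfl) (φa d d le_rfl)
  have hc : Continuous φ := by
    rw [continuous_iff_continuousAt]
    intro t
    refine tendsto_order.2 ⟨fun a ha => ?_, fun b hb => ?_⟩
    · rcases lt_or_ge a 0 with h | h
      · exact Eventually.of_forall fun s => h.trans_le (φ0 s)
      · obtain ⟨_, (rfl | ⟨d, hd, rfl⟩), hr⟩ := exists_lt_of_lt_csSup (insert_nonempty _ _) ha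
        · exact absurd h (not_le.2 hr)
        · obtain ⟨d', h1, h2⟩ := Esurj a (E d) h hr (E1 d).le
          rw [Elt] at h2
          filter_upwards [Ioi_mem_nhds (show (d' : ℝ) < t from lt_of_lt_of_le h2 hd)] with s hs
          exact h1.trans_le (φa d' s (le_of_lt hs))
    · rcases lt_or_ge 1 b with h | h
      · exact Eventually.of_forall fun s => (φ1 s).trans_lt h
      · obtain ⟨d, h1, h2⟩ := Esurj (φ t) b (φ0 t) hb h
        have : t < d := by
          by_contra hh
          exact absurd (φa d t (not_lt.1 hh)) (not_le.2 h1)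
        filter_upwards [Iio_mem_nhds this] with s hs
        exact (φb d s (le_of_lt hs)).trans_lt h2
  have z0 : φ 0 = 0 := by
    refine le_antisymm (le_of_not_gt fun h => ?_) (φ0 0)
    obtain ⟨d, -, hd⟩ := Esurj 0 (φ 0) le_rfl h (φ1 0)
    exact absurd (φb d 0 (hD1 d d.2).1.le) (not_le.2 hd)
  have z1 : φ 1 = 1 := by
    refine le_antisymm (φ1 1) (le_of_not_gt fun h => ?_)
    obtain ⟨d, hd, -⟩ := Esurj (φ 1) 1 (φ0 1) h le_rfl
    exact absurd (φa d 1 (h2 (hDF d.2)).2) (not_le.2 hd)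
  have hFc : IsCompact F := isCompact_Icc.of_isClosed_subset h1 h2
  refine ⟨φ, hc, z0, z1, ?_, ?_⟩
  · refine Subset.antisymm ?_ ?_
    · rintro _ ⟨t, -, rfl⟩
      exact ⟨φ0 t, φ1 t⟩
    · intro s hs
      rcases hs.2.lt_or_eq with h | h
      · rw [← (hFc.image hc).isClosed.closure_eq, Metric.mem_closure_iff]
        intro ε hε
        obtain ⟨d, hd1, hd2⟩ := Esurj s (min 1 (s + ε)) hs.1 (lt_min h (by linarith)) (min_le_left _ _)
        refine ⟨φ d, mem_image_of_mem _ (hDF d.2), ?_⟩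
        rw [φd, Real.dist_eq, abs_lt]
        have := hd2.trans_le (min_le_right _ _)
        constructor <;> linarith
      · exact ⟨1, h4, by rw [z1, h]⟩
  · have key : ∀ x ∈ F, ∀ y ∈ F, x < y → (φ x = φ y ↔ γ x = γ y) := by
      intro x hx y hy hxy
      constructor
      · intro hφ
        by_contra hne
        obtain ⟨d, hd, hxd, hdy⟩ := hD2 x hx y hy hxy hne
        obtain ⟨d', hd', hxd', hdd'⟩ := hD2 x hx d (hDF hd) hxd ((hD1 d hd).2.2 x hx hxd)
        have a1 := φb ⟨d', hd'⟩ x hxd'.le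
        have a2 := φa ⟨d, hd⟩ y hdy.le
        have a3 := (Elt ⟨d', hd'⟩ ⟨d, hd⟩).2 hdd'
        linarith
      · intro hγ
        have : S x = S y := by
          simp only [S]
          congr 2
          ext d
          refine ⟨fun h => le_trans h hxy.le, fun h => ?_⟩
          by_contra hh
          have hh : x < d := not_le.1 hh
          rcases (show (d : ℝ) ≤ y from h).lt_or_eq with h' | h'
          · exact hgap hx hy (hDF d.2) hh h' hγ
          · exact (hD1 d d.2).2.2 x hx hh (by rw [h', hγ])
        simp only [φ, this]
    intro x hx y hy
    rcases lt_trichotomy x y with h | h | h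
    · exact key x hx y hy h
    · simp [h]
    · rw [eq_comm, key y hy x hx h, eq_comm]

theorem path_to_arc {X : Type*} [TopologicalSpace X] [T2Space X] {γ : ℝ → X}
    (hγ : Continuous γ) (h01 : γ 0 ≠ γ 1) : ∃ η : ℝ → X, ContinuousOn η (Icc 0 1) ∧
      InjOn η (Icc 0 1) ∧ η 0 = γ 0 ∧ η 1 = γ 1 ∧ η '' Icc 0 1 ⊆ γ '' Icc 0 1 := by
  obtain ⟨F, hF⟩ := exists_minimal_good hγ
  obtain ⟨φ, hφ, z0, z1, him, hfib⟩ := exists_staircase h01 hF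
  obtain ⟨h1, h2, h3, h4, h5⟩ := hF.prop
  have hFc : IsCompact F := isCompact_Icc.of_isClosed_subset h1 h2
  have hs : ∀ s, ∃ t, s ∈ Icc (0 : ℝ) 1 → t ∈ F ∧ φ t = s := by
    intro s
    by_cases h : s ∈ Icc (0 : ℝ) 1
    · rw [← him] at h
      obtain ⟨t, ht⟩ := h
      exact ⟨t, fun _ => ht⟩
    · exact ⟨0, fun h' => absurd h' h⟩
  choose σ hσ using hs
  have hφI : ∀ t ∈ F, φ t ∈ Icc (0 : ℝ) 1 := fun t ht => him ▸ mem_image_of_mem φ ht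
  have hcomp : ∀ t ∈ F, γ (σ (φ t)) = γ t := fun t ht => by
    have := hσ (φ t) (hφI t ht)
    exact (hfib _ this.1 _ ht).1 this.2
  refine ⟨fun s => γ (σ s), ?_, ?_, ?_, ?_, ?_⟩
  · rw [continuousOn_iff_isClosed]
    intro C hC
    refine ⟨φ '' (F ∩ γ ⁻¹' C), ((hFc.inter_right (hC.preimage hγ)).image hφ).isClosed, ?_⟩
    ext s
    constructor
    · rintro ⟨hsC, hsI⟩
      exact ⟨⟨σ s, ⟨(hσ s hsI).1, hsC⟩, (hσ s hsI).2⟩, hsI⟩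
    · rintro ⟨⟨t, ⟨htF, htC⟩, rfl⟩, hsI⟩
      refine ⟨?_, hsI⟩
      change γ (σ (φ t)) ∈ C
      rw [hcomp t htF]; exact htC
  · intro s hs s' hs' e
    have := (hfib _ (hσ s hs).1 _ (hσ s' hs').1).2 e
    rwa [(hσ s hs).2, (hσ s' hs').2] at this
  · have := hcomp 0 h3
    rwa [z0] at this
  · have := hcomp 1 h4
    rwa [z1] at this
  · rintro _ ⟨s, hs, rfl⟩
    exact ⟨σ s, h2 (hσ s hs).1, rfl⟩

/-- An arc with a globally continuous parametrisation. -/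
theorem arc_of_joinedIn {X : Type*} [TopologicalSpace X] [T2Space X] {A : Set X} {p q : X}
    (h : JoinedIn A p q) (hpq : p ≠ q) : ∃ η : ℝ → X, Continuous η ∧ InjOn η (Icc 0 1) ∧
      η 0 = p ∧ η 1 = q ∧ η '' Icc 0 1 ⊆ A := by
  obtain ⟨γ, hγ⟩ := h
  obtain ⟨η, h1, h2, h3, h4, h5⟩ := path_to_arc (γ := γ.extend) γ.continuous_extend (by simpa using hpq)
  have hcl : ∀ t : ℝ, max 0 (min 1 t) ∈ Icc (0 : ℝ) 1 := fun t =>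
    ⟨le_max_left _ _, max_le zero_le_one (min_le_left _ _)⟩
  have hid : ∀ t ∈ Icc (0 : ℝ) 1, max 0 (min 1 t) = t := fun t ht => by
    rw [min_eq_right ht.2, max_eq_right ht.1]
  refine ⟨fun t => η (max 0 (min 1 t)), h1.comp_continuous (by fun_prop) hcl, ?_, ?_, ?_, ?_⟩
  · intro s hs t ht e
    simp only [hid s hs, hid t ht] at e
    exact h2 hs ht e
  · simpa using h3
  · simpa using h4
  · rintro _ ⟨t, ht, rfl⟩
    simp only [hid t ht]
    obtain ⟨s, hs, e⟩ := h5 (mem_image_of_mem η ht)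
    rw [← e, γ.extend_apply hs]
    exact hγ _

theorem circle_of_arcs {X : Type*} [TopologicalSpace X] [T2Space X] {u v : ℝ → X}
    (hu : Continuous u) (hv : Continuous v) (iu : InjOn u (Icc 0 1)) (iv : InjOn v (Icc 0 1))
    (h1 : u 0 = v 1) (h2 : u 1 = v 0)
    (h : ∀ s ∈ Icc (0 : ℝ) 1, ∀ t ∈ Icc (0 : ℝ) 1, u s = v t → s = 0 ∨ s = 1) :
    ∃ S : Set X, Nonempty (S ≃ₜ Circle) := by
  have : Fact ((0 : ℝ) < 2) := ⟨two_pos⟩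
  let f : ℝ → X := fun t => if t ≤ 1 then u t else v (t - 1)
  have hf : Continuous f := by
    refine Continuous.if_le hu (by fun_prop) continuous_id continuous_const ?_
    intro t ht
    rw [ht, sub_self, h2]
  have f0 : f 0 = f (0 + 2) := by
    simp only [f]
    norm_num [h1]
  have key : ∀ s ∈ Ico (0 : ℝ) (0 + 2), ∀ t ∈ Ico (0 : ℝ) (0 + 2), s ≤ t → f s = f t → s = t := by
    intro s hs t ht hst e
    have hs2 := hs.2
    have ht2 := ht.2
    have hs1 := hs.1
    have ht1 := ht.1
    simp only [f] at e
    split_ifs at e with a b b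
    · exact iu ⟨hs.1, a⟩ ⟨ht.1, b⟩ e
    · push Not at b
      have ht' : t - 1 ∈ Icc (0 : ℝ) 1 := ⟨by linarith, by linarith⟩
      rcases h s ⟨hs.1, a⟩ (t - 1) ht' e with rfl | rfl
      · have := iv (by simp) ht' (h1.symm.trans e)
        linarith
      · have := iv (by simp) ht' (h2.symm.trans e)
        linarith
    · linarith
    · have := iv ⟨by linarith, by linarith⟩ ⟨by linarith, by linarith⟩ e
      linarith
  let g : AddCircle (2 : ℝ) → X := AddCircle.liftIco 2 0 f
  have hg : Continuous g := AddCircle.liftIco_continuous f0 hf.continuousOn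
  have ig : Function.Injective g := by
    intro x y e
    have hx : x ∈ (QuotientAddGroup.mk : ℝ → AddCircle (2 : ℝ)) '' Ico 0 (0 + 2) := by
      rw [AddCircle.coe_image_Ico_eq]; trivial
    have hy : y ∈ (QuotientAddGroup.mk : ℝ → AddCircle (2 : ℝ)) '' Ico 0 (0 + 2) := by
      rw [AddCircle.coe_image_Ico_eq]; trivial
    obtain ⟨s, hs, rfl⟩ := hx
    obtain ⟨t, ht, rfl⟩ := hy
    have e' : f s = f t := by
      rw [← AddCircle.liftIco_coe_apply (f := f) hs, ← AddCircle.liftIco_coe_apply (f := f) ht]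
      exact e
    rcases le_total s t with hst | hst
    · rw [key s hs t ht hst e']
    · rw [key t ht s hs hst e'.symm]
  exact ⟨range g, ⟨(hg.isClosedEmbedding ig).isEmbedding.toHomeomorph.symm.trans
    (AddCircle.homeomorphCircle two_ne_zero)⟩⟩

theorem circle_of_two_arcs {X : Type*} [TopologicalSpace X] [T2Space X] {α β : ℝ → X}
    (hα : Continuous α) (hβ : Continuous β) (iα : InjOn α (Icc 0 1)) (iβ : InjOn β (Icc 0 1))
    (h0 : α 0 = β 0) (h1 : α 1 = β 1) {m : ℝ} (hm : m ∈ Icc (0 : ℝ) 1)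
    (hmβ : α m ∉ β '' Icc 0 1) : ∃ S : Set X, Nonempty (S ≃ₜ Circle) := by
  have hK : IsClosed (Icc (0 : ℝ) 1 ∩ α ⁻¹' (β '' Icc 0 1)) :=
    isClosed_Icc.inter ((isCompact_Icc.image hβ).isClosed.preimage hα)
  obtain ⟨a, ⟨haI, c, hc, ec⟩, b, ⟨hbI, d, hd, ed⟩, -, ham, hmb, -, hgap⟩ := gap_around hK
    (a := 0) (b := 1) (m := m) ⟨by simp, 0, by simp, h0.symm⟩ ⟨by simp, 1, by simp, h1.symm⟩
    hm.1 hm.2 (fun h => hmβ h.2)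
  have hab : a < b := ham.trans hmb
  have hcd : c ≠ d := by
    rintro rfl
    exact hab.ne (iα haI hbI (ec.symm.trans ed))
  have conv : ∀ {x y s : ℝ}, x ∈ Icc (0 : ℝ) 1 → y ∈ Icc (0 : ℝ) 1 → s ∈ Icc (0 : ℝ) 1 →
      x + (y - x) * s ∈ Icc (0 : ℝ) 1 := by
    rintro x y s ⟨hx, hx'⟩ ⟨hy, hy'⟩ ⟨hs, hs'⟩
    constructor
    · nlinarith [mul_nonneg hx (sub_nonneg.2 hs'), mul_nonneg hy hs]
    · nlinarith [mul_nonneg (sub_nonneg.2 hx') (sub_nonneg.2 hs'), mul_nonneg (sub_nonneg.2 hy') hs]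
  refine circle_of_arcs (u := fun s => α (a + (b - a) * s)) (v := fun s => β (d + (c - d) * s))
    (by fun_prop) (by fun_prop) ?_ ?_ ?_ ?_ ?_
  · intro s hs t ht e
    have := iα (conv haI hbI hs) (conv haI hbI ht) e
    exact mul_left_cancel₀ (sub_ne_zero.2 hab.ne') (add_left_cancel this)
  · intro s hs t ht e
    have := iβ (conv hd hc hs) (conv hd hc ht) e
    exact mul_left_cancel₀ (sub_ne_zero.2 hcd) (add_left_cancel this)
  · simp [ec]
  · simp [ed]
  · intro s hs t ht e
    by_contra hne
    push Not at hne
    have s0 : 0 < s := lt_of_le_of_ne hs.1 hne.1.symm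
    have s1 : s < 1 := lt_of_le_of_ne hs.2 hne.2
    exact hgap (a + (b - a) * s) ⟨conv haI hbI hs, _, conv hd hc ht, e.symm⟩
      ⟨by nlinarith, by nlinarith⟩

/-- Intersections of closed connected subsets of a dendrite are connected. -/
theorem inter_preconnected {X : Type*} [TopologicalSpace X] (hX : IsDendrite X) {A B : Set X}
    (hA : IsClosed A) (hB : IsClosed B) (cA : IsPreconnected A) (cB : IsPreconnected B) :
    IsPreconnected (A ∩ B) := by
  obtain ⟨-, _, _, _, _, hcirc⟩ := hX
  let _ := TopologicalSpace.metrizableSpaceMetric X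
  have := locPath (X := X)
  rw [isPreconnected_closed_iff]
  rintro t t' ht ht' hsub ⟨p, hpAB, hpt⟩ ⟨q, hqAB, hqt⟩
  by_contra hemp
  rw [not_nonempty_iff_eq_empty] at hemp
  have hdisj : Disjoint (A ∩ B ∩ t) (A ∩ B ∩ t') := by
    rw [disjoint_left]
    rintro x ⟨hx, hx1⟩ ⟨-, hx2⟩
    have : x ∈ A ∩ B ∩ (t ∩ t') := ⟨hx, hx1, hx2⟩
    rw [hemp] at this
    exact this
  obtain ⟨U, V, hU, hV, hPU, hQV, hUV⟩ :=
    normal_separation ((hA.inter hB).inter ht) ((hA.inter hB).inter ht') hdisj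
  have hABUV : A ∩ B ⊆ U ∪ V := fun x hx => (hsub hx).imp (fun h => hPU ⟨hx, h⟩) (fun h => hQV ⟨hx, h⟩)
  obtain ⟨G, H, hG, hH, hAG, hBH, hGH⟩ := normal_separation
    (hA.sdiff (hU.union hV)) (hB.sdiff (hU.union hV)) (by
      rw [disjoint_left]
      rintro x ⟨hx, hx1⟩ ⟨hx', -⟩
      exact hx1 (hABUV ⟨hx, hx'⟩))
  have hpU : p ∈ U := hPU ⟨hpAB, hpt⟩
  have hqV : q ∈ V := hQV ⟨hqAB, hqt⟩
  have hpq : p ≠ q := by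
    rintro rfl
    exact disjoint_left.1 hUV hpU hqV
  have thick : ∀ (C : Set X) (W : Set X), IsPreconnected C → IsOpen W → C ⊆ W → p ∈ C → q ∈ C →
      JoinedIn W p q := by
    intro C W cC hW hCW hp hq
    have h1 : IsPathConnected (connectedComponentIn W p) :=
      (hW.connectedComponentIn.isConnected_iff_isPathConnected).1
        (isConnected_connectedComponentIn_iff.2 (hCW hp))
    exact (h1.joinedIn p (mem_connectedComponentIn (hCW hp)) q
      (cC.subset_connectedComponentIn hp hCW hq)).mono (connectedComponentIn_subset _ _)
  have jA := thick A ((U ∪ V) ∪ G) cA ((hU.union hV).union hG) (fun x hx => by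
    by_cases h : x ∈ U ∪ V
    · exact Or.inl h
    · exact Or.inr (hAG ⟨hx, h⟩)) hpAB.1 hqAB.1
  have jB := thick B ((U ∪ V) ∪ H) cB ((hU.union hV).union hH) (fun x hx => by
    by_cases h : x ∈ U ∪ V
    · exact Or.inl h
    · exact Or.inr (hBH ⟨hx, h⟩)) hpAB.2 hqAB.2
  obtain ⟨α, hα, iα, α0, α1, rα⟩ := arc_of_joinedIn jA hpq
  obtain ⟨β, hβ, iβ, β0, β1, rβ⟩ := arc_of_joinedIn jB hpq
  have hm : ∃ m ∈ Icc (0 : ℝ) 1, α m ∉ U ∪ V := by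
    by_contra hcon
    push Not at hcon
    have hpre : IsPreconnected (α '' Icc 0 1) := isPreconnected_Icc.image α hα.continuousOn
    obtain ⟨x, -, hx1, hx2⟩ := hpre U V hU hV (by rintro _ ⟨m, hm, rfl⟩; exact hcon m hm)
      ⟨p, ⟨0, by simp, α0⟩, hpU⟩ ⟨q, ⟨1, by simp, α1⟩, hqV⟩
    exact disjoint_left.1 hUV hx1 hx2
  obtain ⟨m, hm, hmUV⟩ := hm
  refine hcirc (circle_of_two_arcs hα hβ iα iβ (α0.trans β0.symm) (α1.trans β1.symm) hm ?_)
  intro hmβ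
  have g1 : α m ∈ G := (rα (mem_image_of_mem α hm)).resolve_left hmUV
  have g2 : α m ∈ H := (rβ hmβ).resolve_left hmUV
  exact disjoint_left.1 hGH g1 g2

theorem three {X : Type*} [TopologicalSpace X] (hX : IsDendrite X) {A B C : Set X}
    (hA : IsClosed A) (hB : IsClosed B) (hC : IsClosed C) (cA : IsPreconnected A)
    (cB : IsPreconnected B) (cC : IsPreconnected C) (hAB : (A ∩ B).Nonempty)
    (hAC : (A ∩ C).Nonempty) (hBC : (B ∩ C).Nonempty) : (A ∩ B ∩ C).Nonempty := by
  obtain ⟨x, hxB, hxC⟩ := hBC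
  have h := inter_preconnected hX hA (hB.union hC) cA (cB.union x hxB hxC cC)
  obtain ⟨y, hy, hy1, hy2⟩ := isPreconnected_closed_iff.1 h B C hB hC inter_subset_right
    (hAB.imp fun y hy => ⟨⟨hy.1, Or.inl hy.2⟩, hy.2⟩)
    (hAC.imp fun y hy => ⟨⟨hy.1, Or.inr hy.2⟩, hy.2⟩)
  exact ⟨y, ⟨hy.1, hy1⟩, hy2⟩

theorem helly_aux {X : Type*} [TopologicalSpace X] (hX : IsDendrite X)
    (𝒴 : Set (Set X)) (hfin : 𝒴.Finite) :
    (∀ Y ∈ 𝒴, IsClosed Y) → (∀ Y ∈ 𝒴, IsConnected Y) →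
    (∀ Y ∈ 𝒴, ∀ Z ∈ 𝒴, (Y ∩ Z).Nonempty) → ∀ A : Set X, IsClosed A → IsConnected A →
    (∀ Y ∈ 𝒴, (A ∩ Y).Nonempty) → (A ∩ ⋂₀ 𝒴).Nonempty := by
  induction 𝒴, hfin using Set.Finite.induction_on with
  | empty =>
    intro _ _ _ A _ cA _
    simpa using cA.nonempty
  | @insert Y 𝒴 hY hfin ih =>
    intro hcl hco hpa A hA cA hAY
    have hYm := mem_insert Y 𝒴
    have := ih (fun Z hZ => hcl Z (Or.inr hZ)) (fun Z hZ => hco Z (Or.inr hZ))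
      (fun Z hZ W hW => hpa Z (Or.inr hZ) W (Or.inr hW)) (A ∩ Y) (hA.inter (hcl Y hYm))
      ⟨hAY Y hYm, inter_preconnected hX hA (hcl Y hYm) cA.isPreconnected (hco Y hYm).isPreconnected⟩
      (fun Z hZ => three hX hA (hcl Y hYm) (hcl Z (Or.inr hZ)) cA.isPreconnected
        (hco Y hYm).isPreconnected (hco Z (Or.inr hZ)).isPreconnected (hAY Y hYm)
        (hAY Z (Or.inr hZ)) (hpa Y hYm Z (Or.inr hZ)))
    rwa [sInter_insert, ← inter_assoc]

end DendriteHelly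

/-- Topological Helly theorem for dendrites (finite case). -/
theorem dendrite_helly_finite (X : Type*) [TopologicalSpace X] (hX : IsDendrite X)
    (𝒴 : Set (Set X)) (hfin : 𝒴.Finite)
    (hclosed : ∀ Y ∈ 𝒴, IsClosed Y) (hconn : ∀ Y ∈ 𝒴, IsConnected Y)
    (hpair : ∀ Y ∈ 𝒴, ∀ Z ∈ 𝒴, (Y ∩ Z).Nonempty) :
    (⋂₀ 𝒴).Nonempty := by
  have hc : ConnectedSpace X := hX.2.2.1
  have := DendriteHelly.helly_aux hX 𝒴 hfin hclosed hconn hpair univ isClosed_univ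
    isConnected_univ (fun Y hY => by simpa using (hconn Y hY).nonempty)
  simpa using this
end

section
/- Let X be a dendrite and let 𝒴 be an arbitrary (possibly infinite) collection of closed connected subsets of X with pairwise nonempty intersections. Then ⋂ 𝒴 is nonempty. -/
open Set

theorem dh_chain {X : Type*} [MetricSpace X] {S : Set X} (hS : IsPreconnected S) {x y : X}
    (hx : x ∈ S) (hy : y ∈ S) {η : ℝ} (hη : 0 < η) :
    ∃ n : ℕ, ∃ c : ℕ → X, c 0 = x ∧ (∀ k, n ≤ k → c k = y) ∧
      (∀ k, dist (c k) (c (k+1)) < η) ∧ ∀ k, c k ∈ S := by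
  have key : Relation.ReflTransGen (fun a b => dist a b < η ∧ a ∈ S ∧ b ∈ S) x y := by
    refine hS.induction₂' (fun a b => Relation.ReflTransGen
      (fun a b => dist a b < η ∧ a ∈ S ∧ b ∈ S) a b) ?_ ?_ hx hy
    · intro a ha
      have h1 : ∀ᶠ b in nhdsWithin a S, b ∈ Metric.ball a η :=
        mem_nhdsWithin_of_mem_nhds (Metric.ball_mem_nhds a hη)
      filter_upwards [h1, self_mem_nhdsWithin] with b hb hbS
      exact ⟨.single ⟨by rw [dist_comm]; exact hb, ha, hbS⟩, .single ⟨hb, hbS, ha⟩⟩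
    · intro a b c _ _ _ h1 h2
      exact h1.trans h2
  induction key using Relation.ReflTransGen.head_induction_on with
  | refl => exact ⟨0, fun _ => y, rfl, fun _ _ => rfl, fun _ => by simpa using hη, fun _ => hy⟩
  | head h1 h2 ih =>
    rename_i a b
    obtain ⟨n, c, h0, hn, hd, hm⟩ := ih h1.2.2
    refine ⟨n+1, fun k => Nat.casesOn k a c, rfl, ?_, ?_, ?_⟩
    · rintro (_|k) hk
      · omega
      · exact hn k (by omega)
    · rintro (_|k)
      · simpa [h0] using h1.1
      · exact hd k
    · rintro (_|k)
      · exact h1.2.1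
      · exact hm k

theorem dh_ulc {X : Type*} [MetricSpace X] [CompactSpace X] [LocallyConnectedSpace X]
    {ε : ℝ} (hε : 0 < ε) : ∃ δ > 0, ∀ x y : X, dist x y < δ →
      ∃ S : Set X, IsPreconnected S ∧ x ∈ S ∧ y ∈ S ∧ ∀ z ∈ S, dist z x < ε := by
  obtain ⟨δ, hδ, H⟩ := lebesgue_number_lemma_of_metric (s := (univ : Set X))
    (c := fun x => connectedComponentIn (Metric.ball x (ε/2)) x) isCompact_univ
    (fun i => Metric.isOpen_ball.connectedComponentIn)
    (fun x _ => mem_iUnion.2 ⟨x, mem_connectedComponentIn (Metric.mem_ball_self (by linarith))⟩)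
  refine ⟨δ, hδ, fun x y hxy => ?_⟩
  obtain ⟨i, hi⟩ := H x trivial
  refine ⟨_, isPreconnected_connectedComponentIn, hi (Metric.mem_ball_self hδ),
    hi (by rw [Metric.mem_ball, dist_comm]; exact hxy), fun z hz => ?_⟩
  have h1 := connectedComponentIn_subset _ _ hz
  have h2 := connectedComponentIn_subset _ _ (hi (Metric.mem_ball_self hδ))
  have h3 := dist_triangle_right z x i
  rw [Metric.mem_ball] at h1 h2
  linarith

theorem dh_unif_chain {X : Type*} [MetricSpace X] [CompactSpace X] [LocallyConnectedSpace X]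
    {ε : ℝ} (hε : 0 < ε) : ∃ δ > 0, ∀ η > 0, ∃ N : ℕ, 0 < N ∧ ∀ x y : X, ∃ c : ℕ → X,
      dist x y < δ →
      c 0 = x ∧ (∀ k, N ≤ k → c k = y) ∧ (∀ k, dist (c k) (c (k+1)) < η) ∧
        ∀ k, dist (c k) x < ε := by
  obtain ⟨δ, hδ, H⟩ := dh_ulc (X := X) hε
  refine ⟨δ/2, by linarith, fun η hη => ?_⟩
  let O : ℕ → Set (X × X) := fun n => {p | ∃ c : ℕ → X, c 0 = p.1 ∧ (∀ k, n + 1 ≤ k → c k = p.2) ∧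
    (∀ k, dist (c k) (c (k+1)) < η) ∧ ∀ k, dist (c k) p.1 < ε}
  have hO : ∀ n, IsOpen (O n) := by
    intro n
    rw [isOpen_iff_mem_nhds]
    rintro p ⟨c, h0, hn, hd, he⟩
    let F : X × X → ℕ → X := fun q k => if k = 0 then q.1 else if n + 1 ≤ k then q.2 else c k
    have hF : ∀ k, Continuous fun q => F q k := by
      intro k
      by_cases hk : k = 0
      · simpa [F, hk] using continuous_fst
      by_cases hk' : n + 1 ≤ k
      · simpa only [F, if_neg hk, if_pos hk'] using continuous_snd
      · simpa only [F, if_neg hk, if_neg hk'] using (continuous_const : Continuous fun _ : X × X => c k)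
    have hFp : ∀ k, F p k = c k := by
      intro k
      by_cases hk : k = 0
      · simp [F, hk, h0]
      by_cases hk' : n + 1 ≤ k
      · simp only [F, if_neg hk, if_pos hk', hn k hk']
      · simp only [F, if_neg hk, if_neg hk']
    have e1 : ∀ᶠ q in nhds p, ∀ k ∈ Iic (n+1), dist (F q k) (F q (k+1)) < η := by
      rw [Filter.eventually_all_finite (finite_Iic _)]
      intro k _
      exact ((hF k).dist (hF (k+1))).continuousAt.eventually_lt continuousAt_const
        (by simpa [hFp] using hd k)
    have e2 : ∀ᶠ q in nhds p, ∀ k ∈ Iic (n+1), dist (F q k) q.1 < ε := by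
      rw [Filter.eventually_all_finite (finite_Iic _)]
      intro k _
      exact ((hF k).dist continuous_fst).continuousAt.eventually_lt continuousAt_const
        (by simpa [hFp] using he k)
    filter_upwards [e1, e2] with q h1 h2
    have hbig : ∀ k, n + 1 ≤ k → F q k = q.2 := by
      intro k hk
      have : k ≠ 0 := by omega
      simp only [F, if_neg this, if_pos hk]
    refine ⟨F q, by simp [F], hbig, fun k => ?_, fun k => ?_⟩
    · by_cases hk : k ≤ n + 1
      · exact h1 k hk
      · rw [hbig k (by omega), hbig (k+1) (by omega)]; simpa using hη
    · by_cases hk : k ≤ n + 1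
      · exact h2 k hk
      · rw [hbig k (by omega), ← hbig (n+1) le_rfl]; exact h2 _ (by simp)
  have hD : IsCompact {p : X × X | dist p.1 p.2 ≤ δ/2} :=
    (isClosed_le (by fun_prop) (by fun_prop)).isCompact
  have mono : Monotone O := by
    rintro m n hmn p ⟨c, h0, hn, hd, he⟩
    exact ⟨c, h0, fun k hk => hn k (by omega), hd, he⟩
  obtain ⟨n, hn⟩ := hD.elim_directed_cover O hO (by
    rintro ⟨x, y⟩ hxy
    obtain ⟨S, hS, hxS, hyS, hb⟩ := H x y (by simp at hxy; linarith)
    obtain ⟨n, c, h0, hn, hd, hm⟩ := dh_chain hS hxS hyS hη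
    exact mem_iUnion.2 ⟨n, c, h0, fun k hk => hn k (by omega), hd, fun k => hb _ (hm k)⟩)
    mono.directed_le
  refine ⟨n+1, by omega, fun x y => ?_⟩
  by_cases hxy : dist x y < δ/2
  · obtain ⟨c, hc⟩ := hn (show (x,y) ∈ _ from hxy.le)
    exact ⟨c, fun _ => hc⟩
  · exact ⟨fun _ => x, fun h => absurd h hxy⟩

theorem dh_joined {X : Type*} [MetricSpace X] [CompactSpace X] [LocallyConnectedSpace X]
    {ε : ℝ} (hε : 0 < ε) : ∃ δ > 0, ∀ x y : X, dist x y < δ →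
      JoinedIn (Metric.ball x (3 * ε)) x y := by
  have he : ∀ n : ℕ, 0 < ε / 2 / 2 ^ n := fun n => by positivity
  have A := fun n => dh_unif_chain (X := X) (he n)
  choose δ hδ H using A
  have B := fun n => H n (δ (n+1)) (hδ _)
  choose N hN c hc using B
  refine ⟨δ 0, hδ 0, fun x y hxy => ?_⟩
  let P : ℕ → ℕ → X := fun n => Nat.rec (fun k => if k = 0 then x else y)
    (fun n Q k => c n (Q (k / N n)) (Q (k / N n + 1)) (k % N n)) n
  have P0 : ∀ k, P 0 k = if k = 0 then x else y := fun k => rfl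
  have PS : ∀ n k, P (n+1) k = c n (P n (k / N n)) (P n (k / N n + 1)) (k % N n) := fun n k => rfl
  have inv : ∀ n k, dist (P n k) (P n (k+1)) < δ n := by
    intro n
    induction n with
    | zero =>
      intro k
      by_cases hk : k = 0
      · simpa [P0, hk] using hxy
      · simpa [P0, hk] using hδ 0
    | succ n ih =>
      intro k
      obtain ⟨h0, h1, h2, h3⟩ := hc n (P n (k / N n)) (P n (k / N n + 1)) (ih _)
      have hlt := Nat.mod_lt k (hN n)
      have hdm := Nat.div_add_mod k (N n)
      rw [PS, PS]
      by_cases hk : k % N n + 1 < N n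
      · have e1 : (k+1) / N n = k / N n := by
          rw [Nat.div_eq_iff (hN n)]
          rw [Nat.mul_comm (k / N n) (N n)]; omega
        have e2 : (k+1) % N n = k % N n + 1 := by
          rw [Nat.add_mod_of_add_mod_lt] <;> rw [Nat.mod_eq_of_lt (a := 1) (by omega)]
          exact hk
        rw [e1, e2]; exact h2 _
      · have hk' : k + 1 = N n * (k / N n + 1) := by rw [mul_add]; omega
        have e1 : (k+1) / N n = k / N n + 1 := by
          rw [hk', Nat.mul_div_cancel_left _ (hN n)]
        have e2 : (k+1) % N n = 0 := by rw [hk']; simp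
        rw [e1, e2, (hc n _ _ (ih _)).1]
        have := h2 (k % N n)
        rwa [h1 (k % N n + 1) (by omega)] at this
  let M : ℕ → ℕ := fun n => ∏ i ∈ Finset.range n, N i
  have M0 : M 0 = 1 := by simp [M]
  have MS : ∀ n, M (n+1) = M n * N n := fun n => Finset.prod_range_succ _ _
  have Mpos : ∀ n, 0 < M n := fun n => Finset.prod_pos fun i _ => hN i
  have small : ∀ n k, dist (P n k) (P n (k+1)) < ε / 2 / 2 ^ n := by
    intro n k
    obtain ⟨h0, h1, h2, h3⟩ := hc n _ _ (inv n k)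
    rw [dist_comm]
    simpa [h1 _ le_rfl] using h3 (N n)
  have step : ∀ (t : ℝ) n, dist (P n ⌊t * M n⌋₊) (P (n+1) ⌊t * M (n+1)⌋₊) ≤ ε / 2 / 2 ^ n := by
    intro t n
    have : ⌊t * M (n+1)⌋₊ / N n = ⌊t * M n⌋₊ := by
      rw [MS, Nat.cast_mul, ← mul_assoc, Nat.mul_cast_floor_div_cancel (hN n).ne']
    rw [PS, this, dist_comm]
    exact ((hc n _ _ (inv n _)).2.2.2 _).le
  have cau : ∀ t : ℝ, ∃ z, Filter.Tendsto (fun n => P n ⌊t * M n⌋₊) Filter.atTop (nhds z) :=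
    fun t => cauchySeq_tendsto_of_complete (cauchySeq_of_le_geometric_two (step t))
  choose F hF using cau
  have dF : ∀ (t : ℝ) n, dist (P n ⌊t * M n⌋₊) (F t) ≤ ε / 2 ^ n := fun t n =>
    dist_le_of_le_geometric_two_of_tendsto (step t) (hF t) n
  have cont : Continuous F := by
    rw [Metric.continuous_iff]
    intro s r hr
    obtain ⟨n, hn⟩ := exists_pow_lt_of_lt_one (show 0 < r / (3 * ε) by positivity)
      (show (1/2 : ℝ) < 1 by norm_num)
    have hn' : 3 * (ε / 2 ^ n) < r := by
      rw [lt_div_iff₀ (by positivity)] at hn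
      have : 3 * (ε / 2 ^ n) = (1/2)^n * (3 * ε) := by
        rw [one_div, inv_pow]; field_simp
      linarith
    have key : ∀ a b : ℝ, a ≤ b → b - a < 1 / M n → dist (F a) (F b) < r := by
      intro a b hab hba
      have hM : (0:ℝ) < M n := by exact_mod_cast Mpos n
      have f1 : ⌊a * M n⌋₊ ≤ ⌊b * M n⌋₊ := Nat.floor_mono (by gcongr)
      have f2 : ⌊b * M n⌋₊ ≤ ⌊a * M n⌋₊ + 1 := by
        by_cases ha : 0 ≤ a * M n
        · rw [← Nat.floor_add_one ha]
          apply Nat.floor_mono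
          rw [lt_div_iff₀ hM] at hba
          nlinarith
        · have : ⌊b * M n⌋₊ ≤ 1 := by
            apply Nat.floor_le_of_le
            rw [lt_div_iff₀ hM] at hba
            push_cast; nlinarith
          omega
      have f3 : dist (P n ⌊a * M n⌋₊) (P n ⌊b * M n⌋₊) ≤ ε / 2 ^ n := by
        have hp : ε / 2 / 2 ^ n ≤ ε / 2 ^ n := by gcongr; linarith
        rcases (show ⌊b * M n⌋₊ = ⌊a * M n⌋₊ ∨ ⌊b * M n⌋₊ = ⌊a * M n⌋₊ + 1 by omega) with h | h
        · rw [h, dist_self]; positivity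
        · rw [h]; exact (small n _).le.trans hp
      have f4 := dF a n
      have f5 := dF b n
      have f6 := dist_triangle4 (F a) (P n ⌊a * M n⌋₊) (P n ⌊b * M n⌋₊) (F b)
      rw [dist_comm (F a) (P n _)] at f6
      linarith
    refine ⟨1 / M n, by have := Mpos n; positivity, fun t ht => ?_⟩
    rw [Real.dist_eq, abs_lt] at ht
    rcases le_total t s with h | h
    · exact key t s h (by linarith)
    · rw [dist_comm]; exact key s t h (by linarith)
  have F0 : F 0 = x := by
    refine tendsto_nhds_unique (hF 0) ?_
    have : ∀ n, P n 0 = x := by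
      intro n
      induction n with
      | zero => simp [P0]
      | succ n ih => rw [PS]; simp only [Nat.zero_div, Nat.zero_mod]; rw [(hc n _ _ (inv n _)).1, ih]
    simp [this]
  have F1 : F 1 = y := by
    refine tendsto_nhds_unique (hF 1) ?_
    have : ∀ n, P n (M n) = y := by
      intro n
      induction n with
      | zero => simp [P0, M0]
      | succ n ih =>
        rw [PS, MS, Nat.mul_div_cancel _ (hN n), Nat.mul_mod_left, (hc n _ _ (inv n _)).1, ih]
    simp [this]
  refine JoinedIn.ofLine cont.continuousOn F0 F1 ?_
  rintro _ ⟨t, -, rfl⟩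
  have g1 := dF t 0
  have g2 : dist (P 0 ⌊t * M 0⌋₊) x ≤ ε := by
    have := small 0 0
    simp [P0] at this
    rw [P0]
    split_ifs
    · simpa using hε.le
    · rw [dist_comm]; linarith
  have g3 := dist_triangle_left (F t) x (P 0 ⌊t * M 0⌋₊)
  rw [Metric.mem_ball]
  simp only [pow_zero, div_one] at g1
  linarith

theorem dh_lpc {X : Type*} [MetricSpace X] [CompactSpace X] [LocallyConnectedSpace X] :
    LocallyPathConnectedSpace X := by
  refine ⟨fun x => ⟨fun U => ⟨fun hU => ?_, ?_⟩⟩⟩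
  · obtain ⟨ε, hε, hb⟩ := Metric.mem_nhds_iff.1 hU
    obtain ⟨δ, hδ, H⟩ := dh_joined (X := X) (show 0 < ε/3 by linarith)
    rw [show 3 * (ε/3) = ε by ring] at H
    refine ⟨pathComponentIn (Metric.ball x ε) x, ⟨?_, ?_⟩, pathComponentIn_subset.trans hb⟩
    · refine Filter.mem_of_superset (Metric.ball_mem_nhds x hδ) fun y hy => ?_
      exact H x y (by rw [dist_comm]; exact hy)
    · exact isPathConnected_pathComponentIn (Metric.mem_ball_self hε)
  · rintro ⟨s, ⟨h1, -⟩, h2⟩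
    exact Filter.mem_of_superset h1 h2

/-- Closed subsets of the unit interval, containing both ends, with equal values at ends of gaps. -/
def DhGood {X : Type*} (f : ℝ → X) (C : Set ℝ) : Prop :=
  IsClosed C ∧ C ⊆ Icc 0 1 ∧ (0:ℝ) ∈ C ∧ (1:ℝ) ∈ C ∧
    ∀ s ∈ C, ∀ t ∈ C, s < t → (∀ u ∈ C, s < u → u < t → False) → f s = f t

theorem dh_greatest {C : Set ℝ} (hC : IsClosed C) {a b : ℝ} (hab : a ≤ b) (ha : a ∈ C) :
    ∃ u ∈ C, a ≤ u ∧ u ≤ b ∧ ∀ v ∈ C, v ≤ b → v ≤ u := by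
  obtain ⟨u, hu, hmax⟩ := (isCompact_Icc.inter_left hC : IsCompact (C ∩ Icc a b)).exists_isGreatest
    ⟨a, ha, le_rfl, hab⟩
  refine ⟨u, hu.1, hu.2.1, hu.2.2, fun v hv hvb => ?_⟩
  by_cases h : a ≤ v
  · exact hmax ⟨hv, h, hvb⟩
  · exact (not_le.1 h).le.trans hu.2.1

theorem dh_least {C : Set ℝ} (hC : IsClosed C) {a b : ℝ} (hab : a ≤ b) (hb : b ∈ C) :
    ∃ u ∈ C, a ≤ u ∧ u ≤ b ∧ ∀ v ∈ C, a ≤ v → u ≤ v := by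
  obtain ⟨u, hu, hmin⟩ := (isCompact_Icc.inter_left hC : IsCompact (C ∩ Icc a b)).exists_isLeast
    ⟨b, hb, hab, le_rfl⟩
  refine ⟨u, hu.1, hu.2.1, hu.2.2, fun v hv hva => ?_⟩
  by_cases h : v ≤ b
  · exact hmin ⟨hv, hva, h⟩
  · exact hu.2.2.trans (not_le.1 h).le

theorem dh_minimal {X : Type*} [MetricSpace X] {f : ℝ → X} (hf : Continuous f) :
    ∃ C, DhGood f C ∧ ∀ s ∈ C, ∀ t ∈ C, s < t → f s = f t →
      ∀ u ∈ C, s < u → u < t → False := by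
  obtain ⟨C, -, hC⟩ := zorn_superset_nonempty {C | DhGood f C} (by
    intro c hc hch hne
    refine ⟨⋂₀ c, ⟨isClosed_sInter fun C h => (hc h).1, ?_, fun C h => (hc h).2.2.1,
      fun C h => (hc h).2.2.2.1, ?_⟩, fun C h => sInter_subset_of_mem h⟩
    · obtain ⟨C, h⟩ := hne
      exact (sInter_subset_of_mem h).trans (hc h).2.1
    · intro s hs t ht hst hgap
      by_contra hne'
      have hd : 0 < dist (f s) (f t) / 2 := by have := dist_pos.2 hne'; linarith
      obtain ⟨δ₁, hδ₁, H₁⟩ := Metric.continuous_iff.1 hf s _ hd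
      obtain ⟨δ₂, hδ₂, H₂⟩ := Metric.continuous_iff.1 hf t _ hd
      obtain ⟨δ, hδ, hδ1, hδ2, hδ3⟩ : ∃ δ > 0, δ < δ₁ ∧ δ < δ₂ ∧ δ < (t - s)/2 := by
        refine ⟨min (min δ₁ δ₂) ((t-s)/2) / 2, ?_, ?_, ?_, ?_⟩
        · have : 0 < min (min δ₁ δ₂) ((t-s)/2) := lt_min (lt_min hδ₁ hδ₂) (by linarith)
          linarith
        all_goals
          have : 0 < min (min δ₁ δ₂) ((t-s)/2) := lt_min (lt_min hδ₁ hδ₂) (by linarith)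
          have h1 := min_le_left (min δ₁ δ₂) ((t-s)/2)
          have h2 := min_le_right (min δ₁ δ₂) ((t-s)/2)
          have h3 := min_le_left δ₁ δ₂
          have h4 := min_le_right δ₁ δ₂
          linarith
      have : Nonempty c := hne.to_subtype
      obtain ⟨⟨C, hCc⟩, hC⟩ := (isCompact_Icc (a := s + δ) (b := t - δ)).elim_directed_family_closed
        (fun C : c => (C : Set ℝ)) (fun C => (hc C.2).1) (by
          rw [← sInter_eq_iInter, ← disjoint_iff_inter_eq_empty, Set.disjoint_left]
          intro u hu hu'
          exact hgap u hu' (by linarith [hu.1]) (by linarith [hu.2]))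
          (by
            intro A B
            rcases hch.total A.2 B.2 with h | h
            · exact ⟨A, le_rfl, h⟩
            · exact ⟨B, h, le_rfl⟩)
      have hC' : ∀ v ∈ C, s + δ ≤ v → v ≤ t - δ → False := fun v hv h1 h2 => by
        have : v ∈ Icc (s+δ) (t-δ) ∩ C := ⟨⟨h1, h2⟩, hv⟩
        rw [hC] at this; exact this
      obtain ⟨u, huC, hu1, hu2, hu3⟩ := dh_greatest (hc hCc).1 (show s ≤ s + δ by linarith)
        (hs C hCc)
      obtain ⟨v, hvC, hv1, hv2, hv3⟩ := dh_least (hc hCc).1 (show t - δ ≤ t by linarith)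
        (ht C hCc)
      have huv : f u = f v := by
        refine (hc hCc).2.2.2.2 u huC v hvC (by linarith) fun w hw h1 h2 => ?_
        by_cases h3 : w ≤ s + δ
        · linarith [hu3 w hw h3]
        by_cases h4 : t - δ ≤ w
        · linarith [hv3 w hw h4]
        · exact hC' w hw (by linarith) (by linarith)
      have d1 := H₁ u (by rw [Real.dist_eq, abs_lt]; constructor <;> linarith)
      have d2 := H₂ v (by rw [Real.dist_eq, abs_lt]; constructor <;> linarith)
      have d3 := dist_triangle_left (f s) (f t) (f u)
      rw [huv] at d1 d3
      linarith) (Icc 0 1)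
    ⟨isClosed_Icc, subset_rfl, by simp, by simp, fun s hs t ht hst h =>
      (h ((s+t)/2) ⟨by linarith [hs.1, ht.1], by linarith [hs.2, ht.2]⟩
        (by linarith) (by linarith)).elim⟩
  refine ⟨C, hC.prop, fun s hs t ht hst hfst u hu hsu hut => ?_⟩
  have hg := hC.prop
  have good : DhGood f (C \ Ioo s t) := by
    refine ⟨hg.1.sdiff isOpen_Ioo, sdiff_subset.trans hg.2.1,
      ⟨hg.2.2.1, fun h => by linarith [h.1, (hg.2.1 hs).1]⟩,
      ⟨hg.2.2.2.1, fun h => by linarith [h.2, (hg.2.1 ht).2]⟩, ?_⟩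
    rintro a ⟨ha, ha'⟩ b ⟨hb, hb'⟩ hab hgap
    have as : s ∉ Ioo s t := by simp
    have htIoo : t ∉ Ioo s t := by simp
    by_cases has : a < s
    · by_cases hbs : b ≤ s
      · refine hg.2.2.2.2 a ha b hb hab fun w hw h1 h2 => ?_
        exact hgap w ⟨hw, fun h => by linarith [h.1]⟩ h1 h2
      · exact (hgap s ⟨hs, as⟩ has (not_le.1 hbs)).elim
    · by_cases hat : a < t
      · have ea : a = s := by
          by_contra hne
          exact ha' ⟨lt_of_le_of_ne (not_lt.1 has) (Ne.symm hne), hat⟩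
        subst ea
        have hbt : t ≤ b := by
          by_contra h
          exact hb' ⟨hab, not_le.1 h⟩
        rcases hbt.eq_or_lt with h | h
        · rw [← h]; exact hfst
        · exact (hgap t ⟨ht, htIoo⟩ hst h).elim
      · refine hg.2.2.2.2 a ha b hb hab fun w hw h1 h2 => ?_
        exact hgap w ⟨hw, fun h => by linarith [h.2]⟩ h1 h2
  have := hC.eq_of_subset good sdiff_subset
  rw [← this] at hu
  exact hu.2 ⟨hsu, hut⟩

theorem dh_monotone_path {X : Type*} [MetricSpace X] {f : ℝ → X} (hf : Continuous f) :
    ∃ h : ℝ → X, Continuous h ∧ h 0 = f 0 ∧ h 1 = f 1 ∧ (∀ t, h t ∈ f '' Icc 0 1) ∧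
      ∀ s u t, s ≤ u → u ≤ t → h s = h t → h u = h s := by
  obtain ⟨C, ⟨hcl, hsub, h0, h1, hgap⟩, hmin⟩ := dh_minimal hf
  have hρ : ∀ t : ℝ, ∃ u ∈ C, 0 ≤ u ∧ u ≤ max t 0 ∧ ∀ v ∈ C, v ≤ max t 0 → v ≤ u :=
    fun t => dh_greatest hcl (le_max_right t 0) h0
  choose ρ ρC ρ0 ρle ρmax using hρ
  have ρmono : ∀ s t, s ≤ t → ρ s ≤ ρ t := fun s t hst =>
    ρmax t _ (ρC s) ((ρle s).trans (max_le_max_right 0 hst))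
  have key : ∀ s t, s ≤ t → ρ s = ρ t ∨ ∃ c ∈ C, c ≤ ρ t ∧ ρ t - c ≤ t - s ∧ f (ρ s) = f c ∧
      ∀ u, s ≤ u → ρ u = ρ s ∨ c ≤ ρ u := by
    intro s t hst
    by_cases heq : ρ s = ρ t
    · exact .inl heq
    right
    have big : ∀ u, s ≤ u → ρ u ≠ ρ s → max s 0 < ρ u := by
      intro u hu hne
      by_contra hcon
      exact hne (le_antisymm (ρmax s _ (ρC u) (not_lt.1 hcon)) (ρmono _ _ hu))
    have hb := big t hst (Ne.symm heq)
    obtain ⟨c, hc, hc1, hc2, hc3⟩ := dh_least hcl hb.le (ρC t)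
    refine ⟨c, hc, hc2, ?_, ?_, ?_⟩
    · have a1 := ρle t
      have a2 := le_max_left s 0
      have a3 := le_max_right s 0
      rcases le_total t 0 with ht | ht
      · rw [max_eq_right ht] at a1; linarith
      · rw [max_eq_left ht] at a1; linarith
    · rcases eq_or_lt_of_le ((ρle s).trans hc1) with h | h
      · rw [h]
      · refine hgap _ (ρC s) _ hc h fun w hw w1 w2 => ?_
        rcases le_total w (max s 0) with h' | h'
        · linarith [ρmax s w hw h']
        · linarith [hc3 w hw h']
    · intro u hu
      by_cases hne : ρ u = ρ s
      · exact .inl hne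
      · exact .inr (hc3 _ (ρC u) (big u hu hne).le)
  refine ⟨fun t => f (ρ t), ?_, ?_, ?_, fun t => ⟨ρ t, hsub (ρC t), rfl⟩, ?_⟩
  · have uc := Metric.uniformContinuousOn_iff.1
      ((isCompact_Icc (a := (0:ℝ)) (b := 1)).uniformContinuousOn_of_continuous hf.continuousOn)
    rw [Metric.continuous_iff]
    intro s ε hε
    obtain ⟨δ, hδ, H⟩ := uc ε hε
    have K : ∀ a b, a ≤ b → b - a < δ → dist (f (ρ a)) (f (ρ b)) < ε := by
      intro a b hab hd
      rcases key a b hab with h | ⟨c, hc, h1, h2, h3, -⟩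
      · rw [h, dist_self]; exact hε
      · rw [h3]
        refine H _ (hsub hc) _ (hsub (ρC b)) ?_
        rw [Real.dist_eq, abs_lt]; constructor <;> linarith
    refine ⟨δ, hδ, fun t ht => ?_⟩
    rw [Real.dist_eq, abs_lt] at ht
    rcases le_total t s with h | h
    · exact K t s h (by linarith)
    · rw [dist_comm]; exact K s t h (by linarith)
  · have : ρ 0 = 0 := le_antisymm (by simpa using ρle 0) (ρ0 0)
    simp [this]
  · have : ρ 1 = 1 := le_antisymm (by simpa using ρle 1) (ρmax 1 1 h1 (by simp))
    simp [this]
  · intro s u t hsu hut heq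
    simp only at heq ⊢
    rcases key s t (hsu.trans hut) with h | ⟨c, hc, h1, h2, h3, h4⟩
    · rw [le_antisymm (h ▸ ρmono u t hut) (ρmono s u hsu)]
    · rcases h4 u hsu with h | h
      · rw [h]
      · rcases eq_or_lt_of_le h with h5 | h5
        · rw [← h5, h3]
        rcases eq_or_lt_of_le (ρmono u t hut) with h6 | h6
        · rw [h6, heq]
        · exact (hmin c hc _ (ρC t) (h5.trans h6) (by rw [← h3, heq]) _ (ρC u) h5 h6).elim

theorem dh_gauge {X : Type*} [MetricSpace X] [CompactSpace X] {h : ℝ → X} (hc : Continuous h)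
    (hfib : ∀ s u t, s ≤ u → u ≤ t → h s = h t → h u = h s) :
    ∃ g : ℝ → ℝ, Continuous g ∧ Monotone g ∧ ∀ s t, g s = g t ↔ h s = h t := by
  let G : ℝ → ℝ → ℝ := fun q t =>
    sSup ((fun u : ℝ => dist (h (q + u * (max t q - q))) (h q)) '' Icc 0 1)
  let D := Metric.diam (univ : Set X)
  have hD : ∀ x y : X, dist x y ≤ D := fun x y =>
    Metric.dist_le_diam_of_mem isCompact_univ.isBounded trivial trivial
  have Gcont : ∀ q, Continuous (G q) := fun q =>
    isCompact_Icc.continuous_sSup (f := fun t u : ℝ => dist (h (q + u * (max t q - q))) (h q))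
      (by
        apply Continuous.dist _ continuous_const
        apply hc.comp
        fun_prop)
  have Gge : ∀ q t v, q ≤ v → v ≤ max t q → dist (h v) (h q) ≤ G q t := by
    intro q t v h1 h2
    apply le_csSup ⟨D, by rintro _ ⟨u, -, rfl⟩; exact hD _ _⟩
    rcases eq_or_lt_of_le (h1.trans h2) with h3 | h3
    · refine ⟨0, by simp, ?_⟩
      have : v = q := by linarith
      simp [this]
    · have : 0 < max t q - q := by linarith
      refine ⟨(v - q) / (max t q - q), ⟨by apply div_nonneg <;> linarith,
        by rw [div_le_one this]; linarith⟩, ?_⟩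
      simp only
      rw [div_mul_cancel₀ _ this.ne', add_sub_cancel]
  have Gle : ∀ q t B, (∀ v, q ≤ v → v ≤ max t q → dist (h v) (h q) ≤ B) → G q t ≤ B := by
    intro q t B hB
    apply csSup_le ((nonempty_Icc.2 zero_le_one).image _)
    rintro _ ⟨u, hu, rfl⟩
    have : 0 ≤ max t q - q := by linarith [le_max_right t q]
    apply hB
    · nlinarith [hu.1]
    · nlinarith [hu.2]
  have Gmono : ∀ q s t, s ≤ t → G q s ≤ G q t := fun q s t hst =>
    Gle _ _ _ fun v h1 h2 => Gge _ _ _ h1 (h2.trans (max_le_max_right q hst))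
  have G0 : ∀ q t, 0 ≤ G q t := fun q t => by
    simpa using Gge q t q le_rfl (le_max_right _ _)
  have GD : ∀ q t, G q t ≤ D := fun q t => Gle _ _ _ fun _ _ _ => hD _ _
  have Gconst : ∀ q s t, s ≤ t → h s = h t → G q s = G q t := by
    intro q s t hst heq
    refine le_antisymm (Gmono _ _ _ hst) (Gle _ _ _ fun v h1 h2 => ?_)
    by_cases hv : v ≤ max s q
    · exact Gge _ _ _ h1 hv
    · have hsv : s < v := (le_max_left s q).trans_lt (not_le.1 hv)
      have hqv : q < v := (le_max_right s q).trans_lt (not_le.1 hv)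
      have hvt : v ≤ t := by
        rcases le_max_iff.1 h2 with h | h
        · exact h
        · linarith
      have e1 := hfib s v t hsv.le hvt heq
      rcases le_total q s with h | h
      · rw [e1]; exact Gge _ _ _ h (le_max_left _ _)
      · rw [e1, hfib s q t h (hqv.le.trans hvt) heq, dist_self]; exact G0 _ _
  let q : ℕ → ℝ := TopologicalSpace.denseSeq ℝ
  have hq : DenseRange q := TopologicalSpace.denseRange_denseSeq ℝ
  have hbd : ∀ n t, ‖G (q n) t * (1/2)^n‖ ≤ D * (1/2)^n := by
    intro n t
    rw [Real.norm_of_nonneg (mul_nonneg (G0 _ _) (by positivity))]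
    gcongr
    exact GD _ _
  have hsum : Summable fun n : ℕ => D * (1/2 : ℝ)^n := summable_geometric_two.mul_left D
  have hs : ∀ t, Summable fun n => G (q n) t * (1/2)^n := fun t =>
    Summable.of_norm_bounded hsum fun n => hbd n t
  have le : ∀ s t, s ≤ t → ∀ n, G (q n) s * (1/2)^n ≤ G (q n) t * (1/2)^n := by
    intro s t hst n
    gcongr
    exact Gmono _ _ _ hst
  have main : ∀ s t, s ≤ t →
      ((∑' n, G (q n) s * (1/2)^n = ∑' n, G (q n) t * (1/2)^n) ↔ h s = h t) := by
    intro s t hst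
    constructor
    · intro heq
      by_contra hne
      have hst' : s < t := lt_of_le_of_ne hst (fun e => hne (by rw [e]))
      have ho : IsOpen ({v | h v ≠ h t} ∩ Iio t) :=
        (isOpen_ne_fun hc continuous_const).inter isOpen_Iio
      obtain ⟨r, hr, hball⟩ := Metric.isOpen_iff.1 ho s ⟨hne, hst'⟩
      obtain ⟨n, hn⟩ := hq.exists_mem_open (isOpen_Ioo (a := s) (b := s + r)) ⟨s + r/2, by
        constructor <;> linarith⟩
      have hmem := hball (show q n ∈ Metric.ball s r by
        rw [Metric.mem_ball, Real.dist_eq, abs_lt]; constructor <;> linarith [hn.1, hn.2])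
      have z : G (q n) s ≤ 0 := Gle _ _ _ fun v h1 h2 => by
        rw [max_eq_right hn.1.le] at h2
        rw [le_antisymm h2 h1, dist_self]
      have p : 0 < G (q n) t :=
        (dist_pos.2 (Ne.symm hmem.1)).trans_le
          (Gge _ _ _ (le_of_lt hmem.2) (le_max_left _ _))
      have := Summable.tsum_lt_tsum (i := n) (le s t hst)
        (by have : (0:ℝ) < (1/2)^n := by positivity
            nlinarith) (hs s) (hs t)
      exact this.ne heq
    · intro heq
      congr 1
      ext n
      rw [Gconst _ s t hst heq]
  refine ⟨fun t => ∑' n, G (q n) t * (1/2)^n, ?_, ?_, ?_⟩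
  · exact continuous_tsum (fun n => (Gcont _).mul continuous_const) hsum hbd
  · intro s t hst
    exact Summable.tsum_le_tsum (le s t hst) (hs s) (hs t)
  · intro s t
    rcases le_total s t with h | h
    · exact main s t h
    · rw [eq_comm, main t s h, eq_comm]

theorem dh_arc {X : Type*} [MetricSpace X] [CompactSpace X] {f : ℝ → X} (hf : Continuous f)
    (hne : f 0 ≠ f 1) : ∃ k : ℝ → X, ContinuousOn k (Icc 0 1) ∧ InjOn k (Icc 0 1) ∧
      k 0 = f 0 ∧ k 1 = f 1 ∧ k '' Icc 0 1 ⊆ f '' Icc 0 1 := by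
  obtain ⟨h, hc, h0, h1, hsub, hfib⟩ := dh_monotone_path hf
  obtain ⟨g, gc, gm, gi⟩ := dh_gauge hc hfib
  have h01 : g 0 < g 1 := lt_of_le_of_ne (gm zero_le_one) fun e => hne (by
    rw [← h0, ← h1, (gi 0 1).1 e])
  have hd : 0 < g 1 - g 0 := by linarith
  have sur : ∀ y : ℝ, ∃ t, y ∈ Icc (0:ℝ) 1 → t ∈ Icc (0:ℝ) 1 ∧ g t = g 0 + y * (g 1 - g 0) := by
    intro y
    by_cases hy : y ∈ Icc (0:ℝ) 1
    · obtain ⟨t, ht, e⟩ := intermediate_value_Icc (zero_le_one (α := ℝ)) gc.continuousOn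
        (show g 0 + y * (g 1 - g 0) ∈ Icc (g 0) (g 1) from
          ⟨by nlinarith [hy.1], by nlinarith [hy.2]⟩)
      exact ⟨t, fun _ => ⟨ht, e⟩⟩
    · exact ⟨0, fun h => absurd h hy⟩
  choose σ hσ using sur
  refine ⟨fun y => h (σ y), ?_, ?_, ?_, ?_, ?_⟩
  · rw [continuousOn_iff_isClosed]
    intro F hF
    refine ⟨(fun t => (g t - g 0) / (g 1 - g 0)) '' (Icc 0 1 ∩ h ⁻¹' F), ?_, ?_⟩
    · exact ((isCompact_Icc.inter_right (hF.preimage hc)).image (by fun_prop)).isClosed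
    · ext y
      constructor
      · rintro ⟨hy, hy'⟩
        refine ⟨⟨σ y, ⟨(hσ y hy').1, hy⟩, ?_⟩, hy'⟩
        simp only
        rw [(hσ y hy').2]; field_simp; ring
      · rintro ⟨⟨t, ⟨ht, htF⟩, rfl⟩, hy'⟩
        refine ⟨?_, hy'⟩
        have e := (hσ _ hy').2
        have e' : g (σ ((g t - g 0) / (g 1 - g 0))) = g t := by
          rw [e]; field_simp; ring
        rw [gi] at e'
        simp only [mem_preimage]
        rw [e']; exact htF
  · intro y hy z hz hyz
    have e := (gi _ _).2 hyz
    rw [(hσ y hy).2, (hσ z hz).2] at e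
    have := add_left_cancel e
    exact mul_right_cancel₀ hd.ne' this
  · rw [← h0, ← gi, (hσ 0 (by simp)).2]; ring
  · rw [← h1, ← gi, (hσ 1 (by simp)).2]; ring
  · rintro _ ⟨y, -, rfl⟩
    exact hsub _

theorem dh_arc' {X : Type*} [MetricSpace X] [CompactSpace X] {U : Set X} {x y : X}
    (hj : JoinedIn U x y) (hne : x ≠ y) : ∃ k : ℝ → X, Continuous k ∧ InjOn k (Icc 0 1) ∧
      k 0 = x ∧ k 1 = y ∧ k '' Icc 0 1 ⊆ U := by
  obtain ⟨γ, hγ⟩ := hj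
  obtain ⟨k, kc, ki, k0, k1, ks⟩ := dh_arc (f := γ.extend) γ.continuous_extend (by simpa using hne)
  have e : ∀ t ∈ Icc (0:ℝ) 1, k (max 0 (min t 1)) = k t := by
    intro t ht
    rw [min_eq_left ht.2, max_eq_right ht.1]
  refine ⟨fun t => k (max 0 (min t 1)), ?_, ?_, ?_, ?_, ?_⟩
  · exact kc.comp_continuous (by fun_prop) fun t => ⟨le_max_left _ _, by simp⟩
  · intro s hs t ht hst
    simp only [e s hs, e t ht] at hst
    exact ki hs ht hst
  · simp only [e 0 (by simp)]; simpa using k0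
  · simp only [e 1 (by simp)]; simpa using k1
  · rintro _ ⟨t, ht, rfl⟩
    simp only [e t ht]
    obtain ⟨u, hu, he⟩ := ks ⟨t, ht, rfl⟩
    rw [← he, γ.extend_apply hu]
    exact hγ _

theorem dh_circle {X : Type*} [TopologicalSpace X] [T2Space X] {f j : ℝ → X}
    (hf : Continuous f) (fi : InjOn f (Icc 0 1)) (hj : Continuous j) (ji : InjOn j (Icc 0 1))
    (e0 : f 0 = j 0) (e1 : f 1 = j 1) {t₀ : ℝ} (ht₀ : t₀ ∈ Icc (0:ℝ) 1)
    (hp : f t₀ ∉ j '' Icc 0 1) : ∃ S : Set X, Nonempty (S ≃ₜ Circle) := by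
  have hK : IsClosed (f ⁻¹' (j '' Icc 0 1)) :=
    ((isCompact_Icc.image hj).isClosed).preimage hf
  obtain ⟨s, ⟨a, ha, has⟩, hs0, hst, hs⟩ := dh_greatest hK ht₀.1
    (show (0:ℝ) ∈ f ⁻¹' (j '' Icc 0 1) from ⟨0, by simp, e0.symm⟩)
  obtain ⟨t, ⟨b, hb, hbt⟩, htt, ht1, ht⟩ := dh_least hK ht₀.2
    (show (1:ℝ) ∈ f ⁻¹' (j '' Icc 0 1) from ⟨1, by simp, e1.symm⟩)
  have hs' : s < t₀ := lt_of_le_of_ne hst (by rintro rfl; exact hp ⟨a, ha, has⟩)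
  have ht' : t₀ < t := lt_of_le_of_ne htt (by rintro rfl; exact hp ⟨b, hb, hbt⟩)
  have hgap : ∀ v, s < v → v < t → f v ∉ j '' Icc 0 1 := by
    intro v h1 h2 h3
    rcases le_total v t₀ with h | h
    · linarith [hs v h3 h]
    · linarith [ht v h3 h]
  have hts : 0 < t - s := by linarith
  have hab : a - b ≠ 0 := by
    intro h
    have : a = b := by linarith
    rw [this, hbt] at has
    have := fi ⟨by linarith, ht1⟩ ⟨hs0, by linarith [ht₀.2]⟩ has
    linarith
  let l : ℝ → X := fun v => if v ≤ 1 then f (s + v * (t - s)) else j (b + (v - 1) * (a - b))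
  have lc : Continuous l := by
    refine Continuous.if_le (by fun_prop) (by fun_prop) continuous_id continuous_const ?_
    rintro v rfl
    simp [hbt]
  have hfm : ∀ v, 0 ≤ v → v ≤ 1 → s + v * (t - s) ∈ Icc (0:ℝ) 1 := fun v h1 h2 =>
    ⟨by nlinarith, by nlinarith⟩
  have hjm : ∀ v, 1 ≤ v → v ≤ 2 → b + (v - 1) * (a - b) ∈ Icc (0:ℝ) 1 := fun v h1 h2 =>
    ⟨by nlinarith [ha.1, hb.1], by nlinarith [ha.2, hb.2]⟩
  have mixed : ∀ v w, 0 ≤ v → v ≤ 1 → 1 < w → w < 2 → l v ≠ l w := by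
    intro v w h1 h2 h3 h4 h
    simp only [l, if_pos h2, if_neg (not_le.2 h3)] at h
    have hjw := hjm w h3.le h4.le
    rcases eq_or_lt_of_le h1 with h5 | h5
    · rw [← h5, zero_mul, add_zero, ← has] at h
      have := ji ha hjw h
      have : (a - b) * (2 - w) = 0 := by linarith
      rcases mul_eq_zero.1 this with h | h
      · exact hab h
      · linarith
    rcases eq_or_lt_of_le h2 with h6 | h6
    · rw [h6, one_mul, add_sub_cancel, ← hbt] at h
      have := ji hb hjw h
      have : (w - 1) * (a - b) = 0 := by linarith
      rcases mul_eq_zero.1 this with h | h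
      · linarith
      · exact hab h
    · exact hgap _ (by nlinarith) (by nlinarith) ⟨_, hjw, h.symm⟩
  have li : InjOn l (Ico 0 2) := by
    intro v hv w hw h
    by_cases h1 : v ≤ 1 <;> by_cases h2 : w ≤ 1
    · simp only [l, if_pos h1, if_pos h2] at h
      have := fi (hfm v hv.1 h1) (hfm w hw.1 h2) h
      exact mul_right_cancel₀ hts.ne' (add_left_cancel this)
    · exact (mixed v w hv.1 h1 (not_le.1 h2) hw.2 h).elim
    · exact (mixed w v hw.1 h2 (not_le.1 h1) hv.2 h.symm).elim
    · simp only [l, if_neg h1, if_neg h2] at h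
      have := ji (hjm v (not_le.1 h1).le hv.2.le) (hjm w (not_le.1 h2).le hw.2.le) h
      have := mul_right_cancel₀ hab (add_left_cancel this)
      linarith
  have l02 : l 0 = l 2 := by
    have : ¬ ((2:ℝ) ≤ 1) := by norm_num
    simp only [l, if_pos (zero_le_one (α := ℝ)), if_neg this, zero_mul, add_zero]
    rw [← has]; congr 1; ring
  have : Fact ((0:ℝ) < 2) := ⟨by norm_num⟩
  have Lc : Continuous (AddCircle.liftIco (2:ℝ) 0 l) :=
    AddCircle.liftIco_zero_continuous l02 lc.continuousOn
  have Li : Function.Injective (AddCircle.liftIco (2:ℝ) 0 l) := by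
    intro x y hxy
    obtain ⟨v, hv, rfl⟩ := AddCircle.coe_image_Ico_eq (2:ℝ) 0 ▸ mem_univ x
    obtain ⟨w, hw, rfl⟩ := AddCircle.coe_image_Ico_eq (2:ℝ) 0 ▸ mem_univ y
    rw [zero_add] at hv hw
    rw [AddCircle.liftIco_zero_coe_apply hv, AddCircle.liftIco_zero_coe_apply hw] at hxy
    rw [li hv hw hxy]
  have emb := (Lc.isClosedEmbedding Li).isEmbedding
  exact ⟨range (AddCircle.liftIco (2:ℝ) 0 l),
    ⟨emb.toHomeomorph.symm.trans (AddCircle.homeomorphCircle (by norm_num))⟩⟩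

theorem dh_unicoherent {X : Type*} [MetricSpace X] [CompactSpace X] [ConnectedSpace X]
    [LocallyConnectedSpace X] (hno : ¬ ∃ S : Set X, Nonempty (S ≃ₜ Circle))
    {A B : Set X} (hA : IsPreconnected A) (hB : IsPreconnected B) : IsPreconnected (A ∩ B) := by
  have : LocallyPathConnectedSpace X := dh_lpc
  apply isPreconnected_of_forall_pair
  intro x hx y hy
  by_cases hne : x = y
  · subst hne
    exact ⟨{x}, by simpa using hx, rfl, rfl, isPreconnected_singleton⟩
  have hU := (isOpen_univ (X := X)).isConnected_iff_isPathConnected.1 isConnected_univ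
  obtain ⟨k, kc, ki, k0, k1, -⟩ := dh_arc' (hU.joinedIn x trivial y trivial) hne
  have key : ∀ S : Set X, IsPreconnected S → x ∈ S → y ∈ S → k '' Icc 0 1 ⊆ S := by
    rintro S hS hxS hyS _ ⟨t, ht, rfl⟩
    by_contra hp
    have hsub : S ⊆ connectedComponentIn {k t}ᶜ x :=
      hS.subset_connectedComponentIn hxS fun z hz (h : z = k t) => hp (h ▸ hz)
    have hop : IsOpen (connectedComponentIn {k t}ᶜ x) :=
      isOpen_compl_singleton.connectedComponentIn
    have hcon : IsConnected (connectedComponentIn {k t}ᶜ x) :=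
      ⟨⟨x, hsub hxS⟩, isPreconnected_connectedComponentIn⟩
    obtain ⟨j, jc, ji, j0, j1, js⟩ := dh_arc' ((hop.isConnected_iff_isPathConnected.1 hcon).joinedIn
      x (hsub hxS) y (hsub hyS)) hne
    refine hno (dh_circle kc ki jc ji (k0.trans j0.symm) (k1.trans j1.symm) ht fun hmem => ?_)
    exact connectedComponentIn_subset _ _ (js hmem) rfl
  exact ⟨k '' Icc 0 1, subset_inter (key A hA hx.1 hy.1) (key B hB hx.2 hy.2),
    ⟨0, by simp, k0⟩, ⟨1, by simp, k1⟩, isPreconnected_Icc.image _ kc.continuousOn⟩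

theorem dh_finite {X ι : Type*} [TopologicalSpace X]
    (uni : ∀ A B : Set X, IsPreconnected A → IsPreconnected B → IsPreconnected (A ∩ B))
    (T : ι → Set X) (hcl : ∀ i, IsClosed (T i)) (hco : ∀ i, IsPreconnected (T i))
    (hpair : ∀ i j, (T i ∩ T j).Nonempty) (F : Finset ι) :
    ∀ Z : Set X, IsClosed Z → IsPreconnected Z → Z.Nonempty → (∀ i, i ∈ F → (Z ∩ T i).Nonempty) →
      (Z ∩ ⋂ i ∈ F, T i).Nonempty := by
  classical
  induction F using Finset.induction_on with
  | empty => intro Z _ _ hZ _; simpa using hZ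
  | insert i F hi ih =>
    intro Z hZ hZc hZn hZi
    have hzi := hZi i (Finset.mem_insert_self i F)
    obtain ⟨z, ⟨hz1, hz2⟩, hz3⟩ := ih (Z ∩ T i) (hZ.inter (hcl i)) (uni _ _ hZc (hco i)) hzi
      (fun m hm => by
        have hzm := hZi m (Finset.mem_insert_of_mem hm)
        obtain ⟨w, hw⟩ := hpair i m
        have hun : IsPreconnected (T i ∪ T m) := (hco i).union w hw.1 hw.2 (hco m)
        have h3 := isPreconnected_closed_iff.1 (uni _ _ hZc hun) (T i) (T m) (hcl i) (hcl m)
          inter_subset_right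
          (by obtain ⟨u, h1, h2⟩ := hzi; exact ⟨u, ⟨h1, .inl h2⟩, h2⟩)
          (by obtain ⟨u, h1, h2⟩ := hzm; exact ⟨u, ⟨h1, .inr h2⟩, h2⟩)
        obtain ⟨u, ⟨h1, -⟩, h2, h3⟩ := h3
        exact ⟨u, ⟨h1, h2⟩, h3⟩)
    refine ⟨z, hz1, ?_⟩
    simp only [Finset.mem_insert, iInter_iInter_eq_or_left]
    exact ⟨hz2, hz3⟩

/-- Topological Helly theorem for dendrites (arbitrary families). -/
theorem dendrite_helly (X : Type*) [TopologicalSpace X] (hX : IsDendrite X)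
    (𝒴 : Set (Set X))
    (hclosed : ∀ Y ∈ 𝒴, IsClosed Y) (hconn : ∀ Y ∈ 𝒴, IsConnected Y)
    (hpair : ∀ Y ∈ 𝒴, ∀ Z ∈ 𝒴, (Y ∩ Z).Nonempty) :
    (⋂₀ 𝒴).Nonempty := by
  obtain ⟨hne, hcomp, hcon, hmet, hlc, hno⟩ := hX
  letI := TopologicalSpace.metrizableSpaceMetric X
  rw [sInter_eq_iInter]
  refine CompactSpace.iInter_nonempty (fun Y => hclosed _ Y.2) fun F => ?_
  have := dh_finite (fun A B hA hB => dh_unicoherent hno hA hB) (fun Y : 𝒴 => (Y : Set X))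
    (fun Y => hclosed _ Y.2) (fun Y => (hconn _ Y.2).isPreconnected)
    (fun Y Z => hpair _ Y.2 _ Z.2) F univ isClosed_univ isPreconnected_univ univ_nonempty
    (fun Y _ => by simpa using (hconn _ Y.2).nonempty)
  simpa using this
end

section
/- Let X be a dendrite and let z₀, z₁, z₂, z₃ be closed connected subsets of X indexed by ℤ/4ℤ such that zᵢ ∩ zᵢ₊₁ ≠ ∅ for all i (indices mod 4). Then z₀ ∩ z₁ ∩ z₂ ≠ ∅ or z₁ ∩ z₂ ∩ z₃ ≠ ∅. -/
open Set

theorem dsl_ulc {X : Type*} [MetricSpace X] [CompactSpace X] [LocallyConnectedSpace X]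
    (ε : ℝ) (hε : 0 < ε) : ∃ δ > 0, ∀ x y : X, dist x y < δ →
      ∃ S : Set X, IsPreconnected S ∧ x ∈ S ∧ y ∈ S ∧ ∀ z ∈ S, dist x z < ε := by
  have h : ∀ c : X, c ∈ connectedComponentIn (Metric.ball c (ε/2)) c := fun c =>
    mem_connectedComponentIn (Metric.mem_ball_self (by positivity))
  obtain ⟨δ, hδ, H⟩ := lebesgue_number_lemma_of_metric (s := (univ : Set X))
    (c := fun c : X => connectedComponentIn (Metric.ball c (ε/2)) c) isCompact_univ
    (fun c => Metric.isOpen_ball.connectedComponentIn)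
    (fun c _ => mem_iUnion.2 ⟨c, h c⟩)
  refine ⟨δ, hδ, fun x y hxy => ?_⟩
  obtain ⟨c, hc⟩ := H x (mem_univ _)
  have hx := hc (Metric.mem_ball_self hδ)
  have hsub := connectedComponentIn_subset (Metric.ball c (ε/2)) c
  refine ⟨_, isPreconnected_connectedComponentIn, hx,
    hc (by rwa [Metric.mem_ball, dist_comm]), fun z hz => ?_⟩
  have h1 := Metric.mem_ball.1 (hsub hx)
  have h2 := Metric.mem_ball.1 (hsub hz)
  have := dist_triangle_right x z c
  linarith

theorem dsl_chain {X : Type*} [MetricSpace X] {S : Set X} (hS : IsPreconnected S)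
    {x y : X} (hx : x ∈ S) (hy : y ∈ S) {δ : ℝ} (hδ : 0 < δ) :
    ∃ (n : ℕ) (c : ℕ → X), c 0 = x ∧ (∀ i ≥ n, c i = y) ∧ (∀ i, c i ∈ S) ∧
      ∀ i, dist (c i) (c (i+1)) < δ := by
  have key : Relation.ReflTransGen (fun a b => a ∈ S ∧ b ∈ S ∧ dist a b < δ) x y := by
    refine hS.induction₂ (Relation.ReflTransGen (fun a b => a ∈ S ∧ b ∈ S ∧ dist a b < δ))
      ?_ ?_ ?_ hx hy
    · intro a ha
      filter_upwards [self_mem_nhdsWithin, mem_nhdsWithin_of_mem_nhds (Metric.ball_mem_nhds a hδ)]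
        with b hb hb'
      exact .single ⟨ha, hb, by rwa [dist_comm]⟩
    · intro a b c _ _ _ h1 h2
      exact h1.trans h2
    · intro a b _ _ h
      have : Std.Symm (fun a b => a ∈ S ∧ b ∈ S ∧ dist a b < δ) :=
        ⟨fun a b h => ⟨h.2.1, h.1, by rw [dist_comm]; exact h.2.2⟩⟩
      exact Relation.ReflTransGen.stdSymm.symm _ _ h
  clear hx
  induction key using Relation.ReflTransGen.head_induction_on with
  | refl => exact ⟨0, fun _ => y, rfl, fun _ _ => rfl, fun _ => hy, fun _ => by simpa⟩
  | @head a b h _ ih =>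
    obtain ⟨n, c, h0, h1, h2, h3⟩ := ih
    refine ⟨n+1, fun i => Nat.casesOn i a c, rfl, ?_, ?_, ?_⟩
    · rintro (_|i) hi
      · omega
      · exact h1 i (by omega)
    · rintro (_|i)
      · exact h.1
      · exact h2 i
    · rintro (_|i)
      · simpa [h0] using h.2.2
      · exact h3 i

theorem dsl_step {X : Type*} [MetricSpace X] {δ δ' ε : ℝ} (hδ' : 0 < δ') (hε : 0 < ε)
    (H : ∀ x y : X, dist x y < δ →
      ∃ S : Set X, IsPreconnected S ∧ x ∈ S ∧ y ∈ S ∧ ∀ z ∈ S, dist x z < ε)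
    (N : ℕ) (x : ℕ → X) (hx : ∀ i < N, dist (x i) (x (i+1)) < δ) :
    ∃ (M : ℕ) (y : ℕ → X), 0 < M ∧ y 0 = x 0 ∧ y (N * M) = x N ∧
      (∀ i < N * M, dist (y i) (y (i+1)) < δ') ∧ ∀ m, dist (x (m / M)) (y m) < ε := by
  have : ∀ i, ∃ (n : ℕ) (c : ℕ → X), c 0 = x i ∧ (i < N → ∀ j ≥ n, c j = x (i+1)) ∧
      (∀ j, dist (x i) (c j) < ε) ∧ ∀ j, dist (c j) (c (j+1)) < δ' := by
    intro i
    by_cases hi : i < N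
    · obtain ⟨S, hS, h1, h2, h3⟩ := H _ _ (hx i hi)
      obtain ⟨n, c, h4, h5, h6, h7⟩ := dsl_chain hS h1 h2 hδ'
      exact ⟨n, c, h4, fun _ => h5, fun j => h3 _ (h6 j), h7⟩
    · exact ⟨0, fun _ => x i, rfl, fun h => absurd h hi, fun _ => by simpa, fun _ => by simpa⟩
  choose n c h0 h1 h2 h3 using this
  obtain ⟨M, hM⟩ : ∃ M, ∀ i < N, n i ≤ M := by
    refine ⟨(Finset.range N).sup n, fun i hi => Finset.le_sup (by simpa)⟩
  refine ⟨M+1, fun m => c (m / (M+1)) (m % (M+1)), by omega, ?_, ?_, ?_, fun m => h2 _ _⟩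
  · simp [h0]
  · simp [h0]
  · intro m hm
    have hi : m / (M+1) < N := Nat.div_lt_of_lt_mul (by rwa [mul_comm])
    have hlt := Nat.mod_lt m (Nat.succ_pos M)
    have hdm := Nat.div_add_mod m (M+1)
    set i := m / (M+1) with hi'
    set j := m % (M+1) with hj'
    rcases Nat.lt_or_ge (j+1) (M+1) with hj | hj
    · have e1 : (m+1) / (M+1) = i := by
        rw [← hdm, add_assoc, Nat.mul_add_div (by omega), Nat.div_eq_of_lt hj, add_zero]
      have e2 : (m+1) % (M+1) = j+1 := by
        rw [← hdm, add_assoc, Nat.mul_add_mod, Nat.mod_eq_of_lt hj]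
      simp only [e1, e2]
      exact h3 _ _
    · have hj2 : j = M := by omega
      have e0 : m + 1 = (M+1) * (i+1) := by rw [← hdm, hj2]; ring
      have e1 : (m+1) / (M+1) = i+1 := by
        rw [e0, Nat.mul_div_cancel_left _ (by omega)]
      have e2 : (m+1) % (M+1) = 0 := by
        rw [e0, Nat.mul_mod_right]
      simp only [e1, e2, h0]
      have := h1 i hi (j+1) (by have := hM i hi; omega)
      rw [← this]
      exact h3 _ _

theorem dsl_path {X : Type*} [MetricSpace X] [CompactSpace X] [LocallyConnectedSpace X]
    (C : ℝ) (hC : 0 < C) : ∃ δ > 0, ∀ p q : X, dist p q < δ →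
      ∃ f : ℝ → X, ContinuousOn f (Icc 0 1) ∧ f 0 = p ∧ f 1 = q ∧
        ∀ t ∈ Icc (0:ℝ) 1, dist p (f t) < 2 * C := by
  have hε : ∀ k : ℕ, 0 < C / 2 / 2 ^ k := fun k => by positivity
  choose δ' hδ' H' using fun k : ℕ => dsl_ulc (X := X) (C / 2 / 2 ^ k) (hε k)
  set δ : ℕ → ℝ := fun k => min (δ' k) (C / 2 ^ k) with hδdef
  have hδ : ∀ k, 0 < δ k := fun k => lt_min (hδ' k) (by positivity)
  have hδC : ∀ k, δ k ≤ C / 2 ^ k := fun k => min_le_right _ _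
  have H : ∀ k, ∀ x y : X, dist x y < δ k →
      ∃ S : Set X, IsPreconnected S ∧ x ∈ S ∧ y ∈ S ∧ ∀ z ∈ S, dist x z < C / 2 / 2 ^ k :=
    fun k x y h => H' k x y (h.trans_le (min_le_left _ _))
  refine ⟨δ 0, hδ 0, fun p q hpq => ?_⟩
  have step : ∀ (k : ℕ) (s : {s : ℕ × (ℕ → X) // 0 < s.1 ∧ s.2 0 = p ∧ s.2 s.1 = q ∧
        ∀ i < s.1, dist (s.2 i) (s.2 (i+1)) < δ k}),
      ∃ s' : {s : ℕ × (ℕ → X) // 0 < s.1 ∧ s.2 0 = p ∧ s.2 s.1 = q ∧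
        ∀ i < s.1, dist (s.2 i) (s.2 (i+1)) < δ (k+1)},
        ∃ M > 0, s'.1.1 = s.1.1 * M ∧ ∀ m, dist (s.1.2 (m / M)) (s'.1.2 m) < C / 2 / 2 ^ k := by
    rintro k ⟨⟨N, x⟩, hN, h0, h1, h2⟩
    obtain ⟨M, y, hM, g0, g1, g2, g3⟩ := dsl_step (hδ (k+1)) (hε k) (H k) N x h2
    exact ⟨⟨⟨N * M, y⟩, Nat.mul_pos hN hM, g0.trans h0, g1.trans h1, g2⟩, M, hM, rfl, g3⟩
  choose nxt hnxt using step
  let s : ∀ k : ℕ, {s : ℕ × (ℕ → X) // 0 < s.1 ∧ s.2 0 = p ∧ s.2 s.1 = q ∧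
        ∀ i < s.1, dist (s.2 i) (s.2 (i+1)) < δ k} := fun k =>
    Nat.rec ⟨⟨1, fun i => if i = 0 then p else q⟩, by simp, by simp, by simp, by
      intro i hi
      have : i = 0 := by simpa using hi
      subst this
      simpa using hpq⟩ (fun k s => nxt k s) k
  have hs : ∀ k, s (k+1) = nxt k (s k) := fun k => rfl
  let N : ℕ → ℕ := fun k => (s k).1.1
  let x : ℕ → ℕ → X := fun k => (s k).1.2
  have hN : ∀ k, 0 < N k := fun k => (s k).2.1
  have hx0 : ∀ k, x k 0 = p := fun k => (s k).2.2.1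
  have hxN : ∀ k, x k (N k) = q := fun k => (s k).2.2.2.1
  have hxd : ∀ k, ∀ i < N k, dist (x k i) (x k (i+1)) < δ k := fun k => (s k).2.2.2.2
  have hst : ∀ k, ∃ M > 0, N (k+1) = N k * M ∧
      ∀ m, dist (x k (m / M)) (x (k+1) m) < C / 2 / 2 ^ k := fun k => hnxt k (s k)
  let a : ℝ → ℕ → X := fun t k => x k ⌊t * N k⌋₊
  have ha : ∀ t k, dist (a t k) (a t (k+1)) ≤ C / 2 / 2 ^ k := by
    intro t k
    obtain ⟨M, hM, hNM, hd⟩ := hst k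
    have : ⌊t * N k⌋₊ = ⌊t * N (k+1)⌋₊ / M := by
      rw [← Nat.floor_div_natCast, hNM]
      congr 1
      have : (M:ℝ) ≠ 0 := by positivity
      push_cast
      field_simp
    show dist (x k ⌊t * N k⌋₊) (x (k+1) ⌊t * N (k+1)⌋₊) ≤ _
    rw [this]
    exact (hd _).le
  have hlim : ∀ t, ∃ y, Filter.Tendsto (a t) Filter.atTop (nhds y) := fun t =>
    cauchySeq_tendsto_of_complete (cauchySeq_of_le_geometric_two (C := C) (ha t))
  choose f hf using hlim
  have hfa : ∀ t k, dist (a t k) (f t) ≤ C / 2 ^ k := fun t k =>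
    dist_le_of_le_geometric_two_of_tendsto (ha t) (hf t) k
  have hclose : ∀ k, ∀ u ∈ Icc (0:ℝ) 1, ∀ v ∈ Icc (0:ℝ) 1, u ≤ v → v - u < 1 / N k →
      dist (f u) (f v) ≤ 3 * (C / 2 ^ k) := by
    intro k u hu v hv huv hlt
    have hNk : (0:ℝ) < N k := by exact_mod_cast hN k
    have h1 : dist (a u k) (a v k) ≤ δ k := by
      have m1 : ⌊u * N k⌋₊ ≤ ⌊v * N k⌋₊ := Nat.floor_mono (by gcongr)
      have m2 : ⌊v * N k⌋₊ ≤ ⌊u * N k⌋₊ + 1 := by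
        rw [← Nat.floor_add_one (by have := hu.1; positivity)]
        apply Nat.floor_mono
        rw [lt_div_iff₀ hNk] at hlt
        linarith
      have m3 : ⌊v * N k⌋₊ ≤ N k := by
        apply Nat.floor_le_of_le
        have := hv.2
        nlinarith
      show dist (x k ⌊u * N k⌋₊) (x k ⌊v * N k⌋₊) ≤ _
      rcases Nat.eq_or_lt_of_le m1 with e | e
      · rw [e, dist_self]; exact (hδ k).le
      · have e2 : ⌊v * N k⌋₊ = ⌊u * N k⌋₊ + 1 := by omega
        rw [e2]
        exact (hxd k _ (by omega)).le
    have h2 := hfa u k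
    have h3 := hfa v k
    have h4 := hδC k
    have h5 := dist_triangle4 (f u) (a u k) (a v k) (f v)
    rw [dist_comm (f u) (a u k)] at h5
    linarith
  have hf0 : f 0 = p := by
    refine tendsto_nhds_unique (hf 0) ?_
    have : a 0 = fun _ => p := by funext k; simp [a, hx0]
    rw [this]; exact tendsto_const_nhds
  have hf1 : f 1 = q := by
    refine tendsto_nhds_unique (hf 1) ?_
    have : a 1 = fun _ => q := by funext k; simp [a, hxN]
    rw [this]; exact tendsto_const_nhds
  refine ⟨f, ?_, hf0, hf1, ?_⟩
  · rw [Metric.continuousOn_iff]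
    intro v hv e he
    obtain ⟨k, hk⟩ : ∃ k : ℕ, 3 * (C / 2 ^ k) < e := by
      obtain ⟨k, hk⟩ := exists_pow_lt_of_lt_one (show 0 < e / (3 * C) by positivity)
        (show (1/2:ℝ) < 1 by norm_num)
      refine ⟨k, ?_⟩
      rw [lt_div_iff₀ (by positivity)] at hk
      calc 3 * (C / 2^k) = (1/2)^k * (3 * C) := by rw [one_div, inv_pow]; ring
        _ < e := hk
    have hNk : (0:ℝ) < N k := by exact_mod_cast hN k
    refine ⟨1 / N k, by positivity, fun u hu huv => ?_⟩
    rw [Real.dist_eq, abs_lt] at huv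
    rcases le_total u v with h | h
    · exact (hclose k u hu v hv h (by linarith)).trans_lt hk
    · rw [dist_comm]
      exact (hclose k v hv u hu h (by linarith)).trans_lt hk
  · intro t ht
    have h1 := hfa t 0
    have h2 : dist p (a t 0) < C := by
      have hpq' : dist p q < C := hpq.trans_le (by simpa using hδC 0)
      have : a t 0 = p ∨ a t 0 = q := by
        show (if _ = 0 then p else q) = p ∨ (if _ = 0 then p else q) = q
        split_ifs <;> simp
      rcases this with h | h <;> rw [h]
      · simpa
      · exact hpq'
    have := dist_triangle p (a t 0) (f t)
    simp at h1
    linarith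

theorem dsl_joined {X : Type*} [MetricSpace X] [CompactSpace X] [LocallyConnectedSpace X]
    {U : Set X} (hU : IsOpen U) (hUc : IsPreconnected U) {p q : X} (hp : p ∈ U) (hq : q ∈ U) :
    JoinedIn U p q := by
  refine hUc.induction₂ (JoinedIn U) ?_ ?_ ?_ hp hq
  · intro a ha
    obtain ⟨e, he, hsub⟩ := Metric.isOpen_iff.1 hU a ha
    obtain ⟨δ, hδ, H⟩ := dsl_path (X := X) (e/2) (by positivity)
    filter_upwards [mem_nhdsWithin_of_mem_nhds (Metric.ball_mem_nhds a hδ)] with b hb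
    obtain ⟨f, hf, h0, h1, h2⟩ := H a b (by rwa [dist_comm])
    refine JoinedIn.ofLine hf h0 h1 ?_
    rintro _ ⟨t, ht, rfl⟩
    apply hsub
    rw [Metric.mem_ball, dist_comm]
    have := h2 t ht
    linarith
  · intro a b c _ _ _ h1 h2
    exact h1.trans h2
  · intro a b _ _ h
    exact h.symm


theorem dsl_last {C : Set ℝ} (hC : IsClosed C) {a t : ℝ} (ha : a ∈ C) (hat : a ≤ t) :
    ∃ s ∈ C, a ≤ s ∧ s ≤ t ∧ ∀ r ∈ C, r ≤ t → r ≤ s := by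
  have hK : IsCompact (C ∩ Icc a t) := isCompact_Icc.inter_left hC
  obtain ⟨s, hs⟩ := hK.exists_isGreatest ⟨a, ha, le_rfl, hat⟩
  refine ⟨s, hs.1.1, hs.1.2.1, hs.1.2.2, fun r hr hrt => ?_⟩
  rcases le_total a r with h | h
  · exact hs.2 ⟨hr, h, hrt⟩
  · exact h.trans hs.1.2.1

theorem dsl_first {C : Set ℝ} (hC : IsClosed C) {b t : ℝ} (hb : b ∈ C) (htb : t ≤ b) :
    ∃ s ∈ C, t ≤ s ∧ s ≤ b ∧ ∀ r ∈ C, t ≤ r → s ≤ r := by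
  have hK : IsCompact (C ∩ Icc t b) := isCompact_Icc.inter_left hC
  obtain ⟨s, hs⟩ := hK.exists_isLeast ⟨b, hb, htb, le_rfl⟩
  refine ⟨s, hs.1.1, hs.1.2.1, hs.1.2.2, fun r hr hrt => ?_⟩
  rcases le_total r b with h | h
  · exact hs.2 ⟨hr, hrt, h⟩
  · exact hs.1.2.2.trans h

theorem dsl_min {X : Type*} [MetricSpace X] {g : ℝ → X} (hg : Continuous g) :
    ∃ C : Set ℝ, C ⊆ Icc 0 1 ∧ IsClosed C ∧ 0 ∈ C ∧ 1 ∈ C ∧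
      (∀ a ∈ C, ∀ b ∈ C, a < b → (∀ c ∈ C, ¬ (a < c ∧ c < b)) → g a = g b) ∧
      (∀ a ∈ C, ∀ b ∈ C, a < b → g a = g b → ∀ c ∈ C, ¬ (a < c ∧ c < b)) := by
  let S : Set (Set ℝ) := {C | C ⊆ Icc 0 1 ∧ IsClosed C ∧ (0:ℝ) ∈ C ∧ (1:ℝ) ∈ C ∧
      (∀ a ∈ C, ∀ b ∈ C, a < b → (∀ c ∈ C, ¬ (a < c ∧ c < b)) → g a = g b)}
  have hI : Icc (0:ℝ) 1 ∈ S := by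
    refine ⟨subset_rfl, isClosed_Icc, by simp, by simp, fun a ha b hb hab h => ?_⟩
    exact absurd ⟨by linarith, by linarith⟩
      (h ((a+b)/2) ⟨by linarith [ha.1, hb.1], by linarith [ha.2, hb.2]⟩)
  obtain ⟨C, -, hC⟩ := zorn_superset_nonempty S (by
    intro c hcS hchain hne
    refine ⟨⋂₀ c, ?_, fun s hs => sInter_subset_of_mem hs⟩
    obtain ⟨C₀, hC₀⟩ := hne
    refine ⟨(sInter_subset_of_mem hC₀).trans (hcS hC₀).1,
      isClosed_sInter fun s hs => (hcS hs).2.1, fun s hs => (hcS hs).2.2.1,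
      fun s hs => (hcS hs).2.2.2.1, fun a ha b hb hab hgap => ?_⟩
    refine eq_of_forall_dist_le fun e he => ?_
    obtain ⟨d1, hd1, h1⟩ := Metric.continuous_iff.1 hg a (e/2) (by positivity)
    obtain ⟨d2, hd2, h2⟩ := Metric.continuous_iff.1 hg b (e/2) (by positivity)
    obtain ⟨η, hη, hη1, hη2, hη3⟩ : ∃ η > 0, η < d1 ∧ η < d2 ∧ η < (b - a)/2 := by
      have : 0 < min (min d1 d2) ((b-a)/2) := by
        refine lt_min (lt_min hd1 hd2) (by linarith)
      refine ⟨min (min d1 d2) ((b-a)/2) / 2, by positivity, ?_, ?_, ?_⟩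
      · have := (min_le_left (min d1 d2) ((b-a)/2)).trans (min_le_left _ _)
        linarith
      · have := (min_le_left (min d1 d2) ((b-a)/2)).trans (min_le_right _ _)
        linarith
      · have := (min_le_right (min d1 d2) ((b-a)/2))
        linarith
    obtain ⟨D, hD, hdisj⟩ : ∃ D ∈ c, ∀ x ∈ D, ¬ (a + η ≤ x ∧ x ≤ b - η) := by
      by_contra hcon
      push Not at hcon
      have hne : (⋂₀ ((fun D => D ∩ Icc (a+η) (b-η)) '' c)).Nonempty := by
        have : Nonempty ((fun D => D ∩ Icc (a+η) (b-η)) '' c) := ⟨⟨_, C₀, hC₀, rfl⟩⟩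
        apply IsCompact.nonempty_sInter_of_directed_nonempty_isCompact_isClosed
        · rintro _ ⟨D, hD, rfl⟩ _ ⟨E, hE, rfl⟩
          rcases hchain.total hD hE with h | h
          · exact ⟨_, ⟨D, hD, rfl⟩, subset_rfl, inter_subset_inter_left _ h⟩
          · exact ⟨_, ⟨E, hE, rfl⟩, inter_subset_inter_left _ h, subset_rfl⟩
        · rintro _ ⟨D, hD, rfl⟩
          obtain ⟨x, hx, h⟩ := hcon D hD
          exact ⟨x, hx, h⟩
        · rintro _ ⟨D, hD, rfl⟩
          exact isCompact_Icc.inter_left (hcS hD).2.1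
        · rintro _ ⟨D, hD, rfl⟩
          exact (hcS hD).2.1.inter isClosed_Icc
      obtain ⟨x, hx⟩ := hne
      have hx' : ∀ D ∈ c, x ∈ D ∩ Icc (a+η) (b-η) := fun D hD => hx _ ⟨D, hD, rfl⟩
      have := (hx' C₀ hC₀).2
      exact hgap x (fun D hD => (hx' D hD).1) ⟨by linarith [this.1], by linarith [this.2]⟩
    obtain ⟨a', ha', l1, l2, l3⟩ := dsl_last (hcS hD).2.1 (ha D hD) (show a ≤ a + η by linarith)
    obtain ⟨b', hb', m1, m2, m3⟩ := dsl_first (hcS hD).2.1 (hb D hD) (show b - η ≤ b by linarith)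
    have heq : g a' = g b' := by
      refine (hcS hD).2.2.2.2 a' ha' b' hb' (by linarith) fun x hx hlt => ?_
      refine hdisj x hx ⟨?_, ?_⟩
      · by_contra h
        exact absurd (l3 x hx (by linarith)) (by linarith [hlt.1])
      · by_contra h
        exact absurd (m3 x hx (by linarith)) (by linarith [hlt.2])
    have e1 := h1 a' (by rw [Real.dist_eq, abs_lt]; constructor <;> linarith)
    have e2 := h2 b' (by rw [Real.dist_eq, abs_lt]; constructor <;> linarith)
    rw [heq] at e1
    have := dist_triangle_left (g a) (g b) (g b')
    linarith) _ hI
  obtain ⟨⟨c1, c2, c3, c4, c5⟩, hmin⟩ := hC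
  refine ⟨C, c1, c2, c3, c4, c5, fun s hs t ht hst hgst c hc hlt => ?_⟩
  have hsub : C \ Ioo s t ∈ S := by
    refine ⟨sdiff_subset.trans c1, c2.sdiff isOpen_Ioo, ⟨c3, ?_⟩, ⟨c4, ?_⟩, ?_⟩
    · intro h; linarith [h.1, (c1 hs).1]
    · intro h; linarith [h.2, (c1 ht).2]
    · intro a ha b hb hab hgap
      by_cases hgap' : ∀ c ∈ C, ¬ (a < c ∧ c < b)
      · exact c5 a ha.1 b hb.1 hab hgap'
      · push Not at hgap'
        obtain ⟨d, hd, had, hdb⟩ := hgap'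
        have hdI : d ∈ Ioo s t := by
          by_contra h
          exact hgap d ⟨hd, h⟩ ⟨had, hdb⟩
        have has : a ≤ s := by
          by_contra h
          exact ha.2 ⟨by linarith, by linarith [hdI.2]⟩
        have htb : t ≤ b := by
          by_contra h
          exact hb.2 ⟨by linarith [hdI.1], by linarith⟩
        have e1 : a = s := by
          by_contra h
          exact hgap s ⟨hs, fun h => lt_irrefl _ h.1⟩
            ⟨lt_of_le_of_ne has h, by linarith [hdI.1]⟩
        have e2 : b = t := by
          by_contra h
          exact hgap t ⟨ht, fun h => lt_irrefl _ h.2⟩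
            ⟨by linarith [hdI.2], lt_of_le_of_ne htb (Ne.symm h)⟩
        rw [e1, e2, hgst]
  exact (hmin hsub sdiff_subset hc).2 hlt

theorem dsl_light {X : Type*} [MetricSpace X] {g : ℝ → X} (hg : Continuous g) :
    ∃ G : ℝ → X, Continuous G ∧ G 0 = g 0 ∧ G 1 = g 1 ∧ (∀ t, G t ∈ g '' Icc 0 1) ∧
      ∀ s ∈ Icc (0:ℝ) 1, ∀ t ∈ Icc (0:ℝ) 1, s ≤ t → G s = G t → ∀ r ∈ Icc s t, G r = G s := by
  obtain ⟨C, c1, c2, c3, c4, c5, c6⟩ := dsl_min hg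
  have : ∀ t : ℝ, 0 ≤ t → ∃ s ∈ C, 0 ≤ s ∧ s ≤ t ∧ ∀ r ∈ C, r ≤ t → r ≤ s :=
    fun t ht => dsl_last c2 c3 ht
  choose! σ σC σ0 σt σm using this
  have mono : ∀ s t, 0 ≤ s → s ≤ t → σ s ≤ σ t := fun s t hs hst =>
    σm t (hs.trans hst) _ (σC s hs) ((σt s hs).trans hst)
  have hcont : ContinuousOn (fun t => g (σ t)) (Icc 0 1) := by
    have huc : UniformContinuousOn g (Icc 0 1) :=
      isCompact_Icc.uniformContinuousOn_of_continuous hg.continuousOn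
    rw [Metric.uniformContinuousOn_iff] at huc
    rw [Metric.continuousOn_iff]
    intro t ht e he
    obtain ⟨d, hd, H⟩ := huc e he
    have key : ∀ s ∈ Icc (0:ℝ) 1, ∀ t ∈ Icc (0:ℝ) 1, s ≤ t → t - s < d →
        dist (g (σ s)) (g (σ t)) < e := by
      intro s hs t ht hst hlt
      by_cases h : σ t ≤ s
      · have : σ s = σ t := le_antisymm (mono s t hs.1 hst) (σm s hs.1 _ (σC t ht.1) h)
        rw [this, dist_self]; exact he
      · push Not at h
        obtain ⟨b, hb, b1, b2, b3⟩ := dsl_first c2 (σC t ht.1) h.le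
        have e1 : g (σ s) = g b := by
          rcases eq_or_lt_of_le ((σt s hs.1).trans b1) with h | h
          · rw [h]
          · refine c5 _ (σC s hs.1) b hb h fun c hc hlt => ?_
            rcases le_total c s with h | h
            · linarith [σm s hs.1 c hc h, hlt.1]
            · linarith [b3 c hc h, hlt.2]
        rw [e1]
        apply H b (c1 hb) _ (c1 (σC t ht.1))
        have := σt t ht.1
        rw [Real.dist_eq, abs_lt]; constructor <;> linarith
    refine ⟨d, hd, fun s hs hlt => ?_⟩
    rw [Real.dist_eq, abs_lt] at hlt
    rcases le_total s t with h | h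
    · exact key s hs t ht h (by linarith)
    · rw [dist_comm]
      exact key t ht s hs h (by linarith)
  have hproj : ∀ t ∈ Icc (0:ℝ) 1, max 0 (min 1 t) = t := fun t ht => by
    rw [min_eq_right ht.2, max_eq_right ht.1]
  have hmem : ∀ t : ℝ, max 0 (min 1 t) ∈ Icc (0:ℝ) 1 := fun t =>
    ⟨le_max_left _ _, max_le zero_le_one (min_le_left _ _)⟩
  refine ⟨fun t => g (σ (max 0 (min 1 t))), ?_, ?_, ?_, ?_, ?_⟩
  · exact hcont.comp_continuous (by fun_prop) hmem
  · have : σ 0 = 0 := le_antisymm (σt 0 le_rfl) (σ0 0 le_rfl)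
    simp [this]
  · have : σ 1 = 1 := le_antisymm (σt 1 zero_le_one) (σm 1 zero_le_one 1 c4 le_rfl)
    simp [this]
  · intro t
    exact ⟨_, c1 (σC _ (hmem t).1), rfl⟩
  · intro s hs t ht hst heq r hr
    have hrI : r ∈ Icc (0:ℝ) 1 := ⟨hs.1.trans hr.1, hr.2.trans ht.2⟩
    simp only [hproj s hs, hproj t ht, hproj r hrI] at heq ⊢
    have m1 := mono s r hs.1 hr.1
    have m2 := mono r t hrI.1 hr.2
    rcases eq_or_lt_of_le m1 with h1 | h1
    · rw [h1]
    rcases eq_or_lt_of_le m2 with h2 | h2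
    · rw [h2, heq]
    exact absurd ⟨h1, h2⟩ (c6 _ (σC s hs.1) _ (σC t ht.1) (h1.trans h2) heq _ (σC r hrI.1))


theorem dsl_param {X : Type*} [MetricSpace X] [CompactSpace X] {G : ℝ → X} (hG : Continuous G)
    (hne : G 0 ≠ G 1)
    (hl : ∀ s ∈ Icc (0:ℝ) 1, ∀ t ∈ Icc (0:ℝ) 1, s ≤ t → G s = G t → ∀ r ∈ Icc s t, G r = G s) :
    ∃ φ : ℝ → ℝ, Continuous φ ∧ φ 0 = 0 ∧ φ 1 = 1 ∧
      (∀ s ∈ Icc (0:ℝ) 1, ∀ t ∈ Icc (0:ℝ) 1, s ≤ t → φ s ≤ φ t) ∧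
      (∀ s ∈ Icc (0:ℝ) 1, ∀ t ∈ Icc (0:ℝ) 1, φ s = φ t ↔ G s = G t) := by
  have : Nonempty X := ⟨G 0⟩
  let x : ℕ → X := TopologicalSpace.denseSeq X
  have hx : DenseRange x := TopologicalSpace.denseRange_denseSeq X
  let m : ℕ → ℝ → ℝ := fun n t => sInf ((fun r => dist (x n) (G (r * t))) '' Icc 0 1)
  have hmc : ∀ n, Continuous (m n) := fun n =>
    IsCompact.continuous_sInf (f := fun t r => dist (x n) (G (r * t))) isCompact_Icc
      (by simp only [Function.HasUncurry.uncurry]; fun_prop)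
  have hle : ∀ n t s, 0 ≤ s → s ≤ t → m n t ≤ dist (x n) (G s) := by
    intro n t s h0 hst
    apply csInf_le
    · exact ⟨0, by rintro _ ⟨r, _, rfl⟩; exact dist_nonneg⟩
    · rcases eq_or_lt_of_le (h0.trans hst) with h | h
      · have : s = 0 := by linarith
        exact ⟨0, by simp, by simp [this]⟩
      · refine ⟨s / t, ⟨by positivity, by rw [div_le_one h]; exact hst⟩, ?_⟩
        simp only
        rw [div_mul_cancel₀ _ h.ne']
  have hat : ∀ n t, 0 ≤ t → ∃ s, 0 ≤ s ∧ s ≤ t ∧ m n t = dist (x n) (G s) := by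
    intro n t ht
    have hK : IsCompact ((fun r => dist (x n) (G (r * t))) '' Icc (0:ℝ) 1) :=
      isCompact_Icc.image (by fun_prop)
    obtain ⟨r, hr, h⟩ := hK.sInf_mem ⟨_, 0, by simp, rfl⟩
    exact ⟨r * t, mul_nonneg hr.1 ht, by nlinarith [hr.2], h.symm⟩
  have hanti : ∀ n s t, 0 ≤ s → s ≤ t → m n t ≤ m n s := by
    intro n s t hs hst
    obtain ⟨r, h0, h1, h2⟩ := hat n s hs
    rw [h2]
    exact hle n t r h0 (h1.trans hst)
  have hm0 : ∀ n t, 0 ≤ m n t := fun n t => by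
    apply Real.sInf_nonneg
    rintro _ ⟨r, _, rfl⟩
    exact dist_nonneg
  obtain ⟨D, hD⟩ : ∃ D, ∀ a b : X, dist a b ≤ D :=
    ⟨Metric.diam (univ : Set X), fun a b =>
      Metric.dist_le_diam_of_mem isCompact_univ.isBounded (mem_univ _) (mem_univ _)⟩
  have hmD : ∀ n t, m n t ≤ D := fun n t => by
    have hb : BddBelow ((fun r => dist (x n) (G (r * t))) '' Icc (0:ℝ) 1) :=
      ⟨0, by rintro _ ⟨r, _, rfl⟩; exact dist_nonneg⟩
    exact (csInf_le hb ⟨0, by simp, rfl⟩).trans (hD _ (G (0 * t)))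
  have hsumD : Summable (fun n : ℕ => (1/2:ℝ)^n * D) := summable_geometric_two.mul_right D
  have hsum : ∀ t, Summable (fun n : ℕ => (1/2:ℝ)^n * m n t) := fun t =>
    Summable.of_nonneg_of_le (fun n => mul_nonneg (by positivity) (hm0 n t))
      (fun n => mul_le_mul_of_nonneg_left (hmD n t) (by positivity)) hsumD
  let ψ : ℝ → ℝ := fun t => ∑' n : ℕ, (1/2:ℝ)^n * m n t
  have hψc : Continuous ψ := by
    refine continuous_tsum (fun n => continuous_const.mul (hmc n)) hsumD fun n t => ?_
    rw [Real.norm_of_nonneg (mul_nonneg (by positivity) (hm0 n t))]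
    exact mul_le_mul_of_nonneg_left (hmD n t) (by positivity)
  have hψanti : ∀ s t, 0 ≤ s → s ≤ t → ψ t ≤ ψ s := fun s t hs hst =>
    (hsum t).tsum_le_tsum (fun n => mul_le_mul_of_nonneg_left (hanti n s t hs hst) (by positivity))
      (hsum s)
  have hψeq : ∀ s ∈ Icc (0:ℝ) 1, ∀ t ∈ Icc (0:ℝ) 1, s ≤ t → G s = G t → ψ s = ψ t := by
    intro s hs t ht hst heq
    show (∑' n : ℕ, (1/2:ℝ)^n * m n s) = ∑' n : ℕ, (1/2:ℝ)^n * m n t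
    congr 1; funext n; congr 1
    refine le_antisymm ?_ (hanti n s t hs.1 hst)
    obtain ⟨r, h0, h1, h2⟩ := hat n t ht.1
    rw [h2]
    rcases le_total r s with h | h
    · exact hle n s r h0 h
    · rw [hl s hs t ht hst heq r ⟨h, h1⟩]
      exact hle n s s hs.1 le_rfl
  have hψlt : ∀ s ∈ Icc (0:ℝ) 1, ∀ t ∈ Icc (0:ℝ) 1, s ≤ t → G s ≠ G t → ψ t < ψ s := by
    intro s hs t ht hst hne
    have hnot : G t ∉ G '' Icc 0 s := by
      rintro ⟨r, hr, h⟩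
      have hr1 : r ∈ Icc (0:ℝ) 1 := ⟨hr.1, hr.2.trans hs.2⟩
      have := hl r hr1 t ht (hr.2.trans hst) h s ⟨hr.2, hst⟩
      exact hne (this.trans h)
    have hcl : IsClosed (G '' Icc 0 s) := (isCompact_Icc.image hG).isClosed
    obtain ⟨η, hη, hball⟩ := Metric.isOpen_iff.1 hcl.isOpen_compl (G t) hnot
    obtain ⟨n, hn⟩ := hx.exists_dist_lt (G t) (half_pos hη)
    refine Summable.tsum_lt_tsum (i := n) (fun k =>
      mul_le_mul_of_nonneg_left (hanti k s t hs.1 hst) (by positivity)) ?_ (hsum t) (hsum s)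
    refine mul_lt_mul_of_pos_left ?_ (by positivity)
    obtain ⟨r, h0, h1, h2⟩ := hat n s hs.1
    have h3 := hle n t t ht.1 le_rfl
    have h4 : η ≤ dist (G r) (G t) := by
      by_contra h
      exact hball (Metric.mem_ball.2 (not_le.1 h)) ⟨r, ⟨h0, h1⟩, rfl⟩
    rw [dist_comm] at hn
    have h5 := dist_triangle_left (G r) (G t) (x n)
    rw [h2]
    linarith
  have h01 : ψ 1 < ψ 0 := hψlt 0 (by simp) 1 (by simp) zero_le_one hne
  have hpos : 0 < ψ 0 - ψ 1 := by linarith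
  refine ⟨fun t => (ψ 0 - ψ t) / (ψ 0 - ψ 1), by fun_prop, by simp, div_self hpos.ne', ?_, ?_⟩
  · intro s hs t ht hst
    have := hψanti s t hs.1 hst
    show (ψ 0 - ψ s) / (ψ 0 - ψ 1) ≤ (ψ 0 - ψ t) / (ψ 0 - ψ 1)
    gcongr
  · intro s hs t ht
    have e : (ψ 0 - ψ s) / (ψ 0 - ψ 1) = (ψ 0 - ψ t) / (ψ 0 - ψ 1) ↔ ψ s = ψ t := by
      rw [div_left_inj' hpos.ne']
      constructor <;> intro h <;> linarith
    show (ψ 0 - ψ s) / (ψ 0 - ψ 1) = (ψ 0 - ψ t) / (ψ 0 - ψ 1) ↔ _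
    rw [e]
    rcases le_total s t with h | h
    · refine ⟨fun h' => ?_, hψeq s hs t ht h⟩
      by_contra hn
      exact absurd (hψlt s hs t ht h hn) (by linarith)
    · refine ⟨fun h' => ?_, fun h' => (hψeq t ht s hs h h'.symm).symm⟩
      by_contra hn
      exact absurd (hψlt t ht s hs h (Ne.symm hn)) (by linarith)

theorem dsl_reparam {X : Type*} [MetricSpace X] [CompactSpace X] {G : ℝ → X} (hG : Continuous G)
    (hne : G 0 ≠ G 1)
    (hl : ∀ s ∈ Icc (0:ℝ) 1, ∀ t ∈ Icc (0:ℝ) 1, s ≤ t → G s = G t → ∀ r ∈ Icc s t, G r = G s) :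
    ∃ F : ℝ → X, Continuous F ∧ InjOn F (Icc 0 1) ∧ F 0 = G 0 ∧ F 1 = G 1 ∧
      ∀ t, F t ∈ range G := by
  obtain ⟨φ, hφ, h0, h1, hmono, hiff⟩ := dsl_param hG hne hl
  have hmaps : ∀ t ∈ Icc (0:ℝ) 1, φ t ∈ Icc (0:ℝ) 1 := fun t ht =>
    ⟨h0 ▸ hmono 0 (by simp) t ht ht.1, h1 ▸ hmono t ht 1 (by simp) ht.2⟩
  have hsurj : ∀ y ∈ Icc (0:ℝ) 1, ∃ t ∈ Icc (0:ℝ) 1, φ t = y := by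
    intro y hy
    have := intermediate_value_Icc (zero_le_one (α := ℝ)) hφ.continuousOn
    rw [h0, h1] at this
    exact this hy
  choose! τ hτ hφτ using hsurj
  let π : Icc (0:ℝ) 1 → Icc (0:ℝ) 1 := fun t => ⟨φ t, hmaps t t.2⟩
  have hπ : Continuous π := by fun_prop
  have hq : Topology.IsQuotientMap π := Topology.IsQuotientMap.of_surjective_continuous
    (fun y => ⟨⟨τ y, hτ y y.2⟩, Subtype.ext (hφτ y y.2)⟩) hπ
  have hcomp : ∀ t ∈ Icc (0:ℝ) 1, G (τ (φ t)) = G t := fun t ht =>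
    (hiff _ (hτ _ (hmaps t ht)) t ht).1 (hφτ _ (hmaps t ht))
  have hF : Continuous (fun y : Icc (0:ℝ) 1 => G (τ y)) := by
    rw [hq.continuous_iff]
    have : (fun y : Icc (0:ℝ) 1 => G (τ y)) ∘ π = fun t : Icc (0:ℝ) 1 => G t := by
      funext t
      exact hcomp t t.2
    rw [this]
    fun_prop
  have hproj : ∀ t ∈ Icc (0:ℝ) 1, max 0 (min 1 t) = t := fun t ht => by
    rw [min_eq_right ht.2, max_eq_right ht.1]
  have hmem : ∀ t : ℝ, max 0 (min 1 t) ∈ Icc (0:ℝ) 1 := fun t =>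
    ⟨le_max_left _ _, max_le zero_le_one (min_le_left _ _)⟩
  refine ⟨fun t => G (τ (max 0 (min 1 t))), ?_, ?_, ?_, ?_, fun t => ⟨_, rfl⟩⟩
  · have hF' : ContinuousOn (fun y => G (τ y)) (Icc (0:ℝ) 1) :=
      continuousOn_iff_continuous_domRestrict.2 hF
    exact hF'.comp_continuous (f := fun t : ℝ => max 0 (min 1 t)) (by fun_prop) hmem
  · intro s hs t ht h
    simp only [hproj s hs, hproj t ht] at h
    rw [← hφτ s hs, ← hφτ t ht]
    exact (hiff _ (hτ s hs) _ (hτ t ht)).2 h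
  · have := hcomp 0 (by simp)
    rw [h0] at this
    simp [this]
  · have := hcomp 1 (by simp)
    rw [h1] at this
    simp [this]

theorem dsl_arc {X : Type*} [MetricSpace X] [CompactSpace X] [LocallyConnectedSpace X]
    {U : Set X} (hU : IsOpen U) (hUc : IsPreconnected U) {p q : X} (hp : p ∈ U) (hq : q ∈ U)
    (hpq : p ≠ q) :
    ∃ F : ℝ → X, Continuous F ∧ InjOn F (Icc 0 1) ∧ F 0 = p ∧ F 1 = q ∧ ∀ t, F t ∈ U := by
  obtain ⟨γ, hγ⟩ := dsl_joined hU hUc hp hq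
  obtain ⟨G, hG, G0, G1, Gm, Gl⟩ := dsl_light (g := γ.extend) γ.continuous_extend
  simp only [Path.extend_zero, Path.extend_one] at G0 G1
  obtain ⟨F, hF, Fi, F0, F1, Fm⟩ := dsl_reparam hG (by rwa [G0, G1]) Gl
  refine ⟨F, hF, Fi, F0.trans G0, F1.trans G1, fun t => ?_⟩
  obtain ⟨s, hs⟩ := Fm t
  obtain ⟨r, hr, hr'⟩ := Gm s
  rw [← hs, ← hr', Path.extend_apply γ hr]
  exact hγ _

theorem dsl_circle {X : Type*} [MetricSpace X] {α β : ℝ → X} (hα : Continuous α)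
    (hβ : Continuous β) (iα : InjOn α (Icc 0 1)) (iβ : InjOn β (Icc 0 1))
    (h1 : α 1 = β 0) (h2 : β 1 = α 0)
    (hd : ∀ s ∈ Ioo (0:ℝ) 1, ∀ t ∈ Icc (0:ℝ) 1, α s ≠ β t) :
    ∃ S : Set X, Nonempty (S ≃ₜ Circle) := by
  let f : ℝ → X := fun t => if t ≤ 1 then α t else β (t - 1)
  have hf : Continuous f := by
    refine Continuous.if_le hα (by fun_prop) continuous_id continuous_const ?_
    rintro t rfl
    simpa using h1
  have hf02 : f 0 = f (0 + 2) := by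
    simp only [f]
    norm_num
    exact h2.symm
  have hinj : InjOn f (Ico 0 2) := by
    have key : ∀ s ∈ Ico (0:ℝ) 2, ∀ t ∈ Ico (0:ℝ) 2, s ≤ 1 → 1 < t → α s ≠ β (t - 1) := by
      intro s hs t ht hs1 ht1 h
      rcases eq_or_lt_of_le hs.1 with h0 | h0
      · rw [← h0, ← h2] at h
        have := iβ (by simp) ⟨by linarith, by linarith [ht.2]⟩ h
        linarith [ht.2]
      rcases eq_or_lt_of_le hs1 with h0' | h0'
      · rw [h0', h1] at h
        have := iβ (by simp) ⟨by linarith, by linarith [ht.2]⟩ h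
        linarith [ht.2]
      · exact hd s ⟨h0, h0'⟩ (t-1) ⟨by linarith, by linarith [ht.2]⟩ h
    intro s hs t ht h
    simp only [f] at h
    split_ifs at h with a b b
    · exact iα ⟨hs.1, a⟩ ⟨ht.1, b⟩ h
    · exact absurd h (key s hs t ht a (not_le.1 b))
    · exact absurd h.symm (key t ht s hs b (not_le.1 a))
    · have := iβ ⟨by linarith, by linarith [hs.2]⟩ ⟨by linarith, by linarith [ht.2]⟩ h
      linarith
  haveI : Fact ((0:ℝ) < 2) := ⟨by norm_num⟩
  have hc : Continuous (AddCircle.liftIco 2 0 f) :=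
    AddCircle.liftIco_continuous hf02 hf.continuousOn
  have hi : Function.Injective (AddCircle.liftIco 2 0 f) := by
    intro a b hab
    obtain ⟨s, hs, rfl⟩ := AddCircle.coe_image_Ico_eq (2:ℝ) 0 ▸ mem_univ a
    obtain ⟨t, ht, rfl⟩ := AddCircle.coe_image_Ico_eq (2:ℝ) 0 ▸ mem_univ b
    rw [AddCircle.liftIco_coe_apply hs, AddCircle.liftIco_coe_apply ht] at hab
    rw [zero_add] at hs ht
    rw [hinj hs ht hab]
  have hemb := hc.isClosedEmbedding hi
  exact ⟨range (AddCircle.liftIco 2 0 f),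
    ⟨hemb.isEmbedding.toHomeomorph.symm.trans (AddCircle.homeomorphCircle (by norm_num))⟩⟩

theorem dsl_lineMap_mem {u v r : ℝ} (hu : u ∈ Icc (0:ℝ) 1) (hv : v ∈ Icc (0:ℝ) 1)
    (hr : r ∈ Icc (0:ℝ) 1) : u + r * (v - u) ∈ Icc (0:ℝ) 1 := by
  obtain ⟨a, b⟩ := hu
  obtain ⟨c, d⟩ := hv
  obtain ⟨e, f⟩ := hr
  constructor <;> nlinarith

theorem dsl_theta {X : Type*} [MetricSpace X] [CompactSpace X] [LocallyConnectedSpace X]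
    {G H U V : Set X} (hG : IsOpen G) (hH : IsOpen H) (hU : IsOpen U) (hV : IsOpen V)
    (hGc : IsPreconnected G) (hHc : IsPreconnected H) (hcov : G ∩ H ⊆ U ∪ V)
    (hdis : ∀ x ∈ G, x ∈ U → x ∉ V) {p q : X} (hpG : p ∈ G) (hpH : p ∈ H) (hpU : p ∈ U)
    (hqG : q ∈ G) (hqH : q ∈ H) (hqV : q ∈ V) :
    ∃ S : Set X, Nonempty (S ≃ₜ Circle) := by
  have hpq : p ≠ q := by
    rintro rfl
    exact hdis p hpG hpU hqV
  obtain ⟨γ, cγ, iγ, γ0, γ1, γG⟩ := dsl_arc hG hGc hpG hqG hpq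
  obtain ⟨δ, cδ, iδ, δ0, δ1, δH⟩ := dsl_arc hH hHc hpH hqH hpq
  have hK : IsClosed (δ '' Icc 0 1) := (isCompact_Icc.image cδ).isClosed
  have hor : ∀ t, γ t ∈ δ '' Icc 0 1 → γ t ∈ U ∨ γ t ∈ V := by
    rintro t ⟨r, _, h⟩
    exact hcov ⟨γG t, h ▸ δH r⟩
  let SU : Set ℝ := γ ⁻¹' (δ '' Icc 0 1 ∩ Vᶜ)
  let SV : Set ℝ := γ ⁻¹' (δ '' Icc 0 1 ∩ Uᶜ)
  have cSU : IsClosed SU := (hK.inter hV.isClosed_compl).preimage cγ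
  have cSV : IsClosed SV := (hK.inter hU.isClosed_compl).preimage cγ
  have m0 : (0:ℝ) ∈ SU := ⟨⟨0, by simp, by rw [δ0, γ0]⟩, by
    rw [γ0]; exact hdis p hpG hpU⟩
  have m1 : (1:ℝ) ∈ SV := ⟨⟨1, by simp, by rw [δ1, γ1]⟩, by
    rw [γ1]; exact fun h => hdis q hqG h hqV⟩
  obtain ⟨t, ht, t0, t1, tm⟩ := dsl_first cSV m1 zero_le_one
  obtain ⟨s, hs, s0, st, sm⟩ := dsl_last cSU m0 t0
  obtain ⟨u, hu, hus⟩ := hs.1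
  obtain ⟨v, hv, hvt⟩ := ht.1
  have hsU : γ s ∈ U := (hor s hs.1).resolve_right hs.2
  have hne : γ s ≠ γ t := fun h => ht.2 (h ▸ hsU)
  have hlt : s < t := lt_of_le_of_ne st (fun h => hne (by rw [h]))
  have huv : u ≠ v := by
    rintro rfl
    exact hne (hus.symm.trans hvt)
  have hsI : s ∈ Icc (0:ℝ) 1 := ⟨s0, st.trans t1⟩
  have htI : t ∈ Icc (0:ℝ) 1 := ⟨t0, t1⟩
  refine dsl_circle (α := fun r => γ (s + r * (t - s))) (β := fun r => δ (v + r * (u - v)))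
    (by fun_prop) (by fun_prop) ?_ ?_ ?_ ?_ ?_
  · intro a ha b hb h
    have := iγ (dsl_lineMap_mem hsI htI ha) (dsl_lineMap_mem hsI htI hb) h
    exact mul_right_cancel₀ (sub_ne_zero.2 hlt.ne') (add_left_cancel this)
  · intro a ha b hb h
    have := iδ (dsl_lineMap_mem hv hu ha) (dsl_lineMap_mem hv hu hb) h
    exact mul_right_cancel₀ (sub_ne_zero.2 huv) (add_left_cancel this)
  · simp [hvt]
  · simp [hus]
  · intro a ha b hb h
    have hr1 : s < s + a * (t - s) := by nlinarith [ha.1]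
    have hr2 : s + a * (t - s) < t := by nlinarith [ha.2]
    have hmem : γ (s + a * (t - s)) ∈ δ '' Icc 0 1 := ⟨_, dsl_lineMap_mem hv hu hb, h.symm⟩
    by_cases hVm : γ (s + a * (t - s)) ∈ V
    · have := tm _ (show s + a * (t - s) ∈ SV from
        ⟨hmem, fun h => hdis _ (γG _) h hVm⟩) (by linarith)
      linarith
    · have := sm _ (show s + a * (t - s) ∈ SU from ⟨hmem, hVm⟩) (by linarith)
      linarith

/-- Acyclicity lemma: four closed connected subsets indexed by ℤ/4ℤ with
consecutive nonempty intersections. -/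
theorem dendrite_square_lemma (X : Type*) [TopologicalSpace X] (hX : IsDendrite X)
    (z : ZMod 4 → Set X)
    (hclosed : ∀ i, IsClosed (z i)) (hconn : ∀ i, IsConnected (z i))
    (hpair : ∀ i, (z i ∩ z (i + 1)).Nonempty) :
    (z 0 ∩ z 1 ∩ z 2).Nonempty ∨ (z 1 ∩ z 2 ∩ z 3).Nonempty := by
  obtain ⟨-, hcomp, -, hmet, hloc, hno⟩ := hX
  letI : MetricSpace X := TopologicalSpace.metrizableSpaceMetric X
  by_contra hcon
  rw [not_or, not_nonempty_iff_eq_empty, not_nonempty_iff_eq_empty] at hcon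
  obtain ⟨c1, c2⟩ := hcon
  obtain ⟨p, hp0, hp1⟩ : (z 0 ∩ z 1).Nonempty := by simpa using hpair 0
  obtain ⟨w, hw1, hw2⟩ : (z 1 ∩ z 2).Nonempty := hpair 1
  obtain ⟨q, hq2, hq3⟩ : (z 2 ∩ z 3).Nonempty := hpair 2
  obtain ⟨y, hy3, hy0⟩ : (z 3 ∩ z 0).Nonempty := hpair 3
  have hA : IsPreconnected (z 0 ∪ z 3) :=
    (hconn 0).isPreconnected.union y hy0 hy3 (hconn 3).isPreconnected
  have hB : IsPreconnected (z 1 ∪ z 2) :=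
    (hconn 1).isPreconnected.union w hw1 hw2 (hconn 2).isPreconnected
  obtain ⟨W, T, oW, oT, hW, hT, hWT⟩ := normal_separation
    ((hclosed 0).union (hclosed 3)) ((hclosed 1).inter (hclosed 2)) (by
      rw [Set.disjoint_left]
      rintro a (h | h) ⟨h1, h2⟩
      · exact (c1 ▸ (⟨⟨h, h1⟩, h2⟩ : a ∈ z 0 ∩ z 1 ∩ z 2) : a ∈ (∅ : Set X))
      · exact (c2 ▸ (⟨⟨h1, h2⟩, h⟩ : a ∈ z 1 ∩ z 2 ∩ z 3) : a ∈ (∅ : Set X)))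
  obtain ⟨U', V', oU', oV', hU', hV', hUV⟩ := normal_separation
    ((hclosed 1).sdiff oT) ((hclosed 2).sdiff oT) (by
      rw [Set.disjoint_left]
      rintro a ⟨h1, h2⟩ ⟨h3, _⟩
      exact h2 (hT ⟨h1, h3⟩))
  have hU : z 1 ⊆ U' ∪ T := fun a ha => by
    by_cases h : a ∈ T
    · exact Or.inr h
    · exact Or.inl (hU' ⟨ha, h⟩)
  have hV : z 2 ⊆ V' ∪ T := fun a ha => by
    by_cases h : a ∈ T
    · exact Or.inr h
    · exact Or.inl (hV' ⟨ha, h⟩)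
  have hsubG := hA.subset_connectedComponentIn (Or.inl hp0) hW
  have hsubH := hB.subset_connectedComponentIn (Or.inl hp1)
    (union_subset_union hU hV)
  refine hno (dsl_theta (G := connectedComponentIn W p)
    (H := connectedComponentIn ((U' ∪ T) ∪ (V' ∪ T)) p) (U := U' ∪ T) (V := V' ∪ T)
    oW.connectedComponentIn ((oU'.union oT).union (oV'.union oT)).connectedComponentIn
    (oU'.union oT) (oV'.union oT) isPreconnected_connectedComponentIn
    isPreconnected_connectedComponentIn
    (inter_subset_right.trans (connectedComponentIn_subset _ _)) ?_
    (hsubG (Or.inl hp0)) (hsubH (Or.inl hp1)) (hU hp1)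
    (hsubG (Or.inr hq3)) (hsubH (Or.inr hq2)) (hV hq2))
  intro a ha hau hav
  have haW := connectedComponentIn_subset _ _ ha
  have haT : a ∉ T := Set.disjoint_left.1 hWT haW
  exact Set.disjoint_left.1 hUV (hau.resolve_right haT) (hav.resolve_right haT)
end
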